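/- Assume assertions (A1), (A2) and (A3) hold, and in addition, if r ≥ 3, that κ_{i+1} ⊆ L_i for all 2 ≤ i < r. Then for every 0 ≤ i ≤ r: (i) Gal(L_i/ℚ) is isomorphic to GL₂(F_ℓ)/S_i, not only abstractly but as an extension of PGL₂(F_ℓ): there is a group isomorphism φ_i : Gal(L_i/ℚ) → GL₂(F_ℓ)/S_i (where GL₂(F_ℓ)/S_i denotes the quotient of GL₂(F_ℓ) by the subgroup of scalar matrices with entry in S_i) such that the composite of φ_i with the natural projection GL₂(F_ℓ)/S_i → PGL₂(F_ℓ) equals the restriction map Gal(L_i/ℚ) → Gal(L_0/ℚ) = PGL₂(F_ℓ); and (ii) such an isomorphism φ_i can be chosen together with a bijection Z_i → V_i making the action of Gal(L_i/ℚ) on the set Z_i of roots of F_i equivalent to the natural action of GL₂(F_ℓ)/S_i on V_i. -/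

import Mathlib

open Matrix Polynomial

noncomputable section

abbrev Om := AlgebraicClosure ℚ

def Sgrp (ℓ i : ℕ) [Fact ℓ.Prime] : Subgroup (ZMod ℓ)ˣ :=
  MonoidHom.range (powMonoidHom (2 ^ i) : (ZMod ℓ)ˣ →* (ZMod ℓ)ˣ)

def scalarGL (ℓ : ℕ) [Fact ℓ.Prime] : (ZMod ℓ)ˣ →* GL (Fin 2) (ZMod ℓ) :=
  Units.map (Matrix.scalar (Fin 2)).toMonoidHom

lemma scalarGL_mem_center (ℓ : ℕ) [Fact ℓ.Prime] (s : (ZMod ℓ)ˣ) :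
    scalarGL ℓ s ∈ Subgroup.center (GL (Fin 2) (ZMod ℓ)) := by
  rw [Subgroup.mem_center_iff]
  intro g
  ext : 1
  simp only [Units.val_mul, scalarGL, Units.coe_map, RingHom.toMonoidHom_eq_coe,
    MonoidHom.coe_coe]
  exact (Matrix.scalar_commute ((s : ZMod ℓ)) (fun r => Commute.all _ _) g.val).symm

def ZS (ℓ i : ℕ) [Fact ℓ.Prime] : Subgroup (GL (Fin 2) (ZMod ℓ)) :=
  (Sgrp ℓ i).map (scalarGL ℓ)

instance (ℓ i : ℕ) [Fact ℓ.Prime] : (ZS ℓ i).Normal := by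
  constructor
  intro n hn g
  have hcen : n ∈ Subgroup.center (GL (Fin 2) (ZMod ℓ)) := by
    obtain ⟨s, _, rfl⟩ := hn
    exact scalarGL_mem_center ℓ s
  have h := (Subgroup.mem_center_iff.mp hcen) g
  have : g * n * g⁻¹ = n := by rw [h, mul_assoc, mul_inv_cancel, mul_one]
  rwa [this]

lemma Sgrp_le_zero (ℓ i : ℕ) [Fact ℓ.Prime] : Sgrp ℓ i ≤ Sgrp ℓ 0 := by
  intro u _
  exact ⟨u, by simp [powMonoidHom]⟩

lemma Sgrp_succ_le (ℓ i : ℕ) [Fact ℓ.Prime] : Sgrp ℓ (i + 1) ≤ Sgrp ℓ i := by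
  rintro u ⟨y, rfl⟩
  exact ⟨y ^ 2, by simp only [powMonoidHom_apply]; rw [← pow_mul, ← pow_succ']⟩

def projQ (ℓ i : ℕ) [Fact ℓ.Prime] :
    (GL (Fin 2) (ZMod ℓ) ⧸ ZS ℓ i) →* (GL (Fin 2) (ZMod ℓ) ⧸ ZS ℓ 0) :=
  QuotientGroup.map _ _ (MonoidHom.id _)
    (fun _ h => Subgroup.map_mono (Sgrp_le_zero ℓ i) h)

def Vset (ℓ : ℕ) : Type := {v : Fin 2 → ZMod ℓ // v ≠ 0}

def vSetoid (ℓ i : ℕ) [Fact ℓ.Prime] : Setoid (Vset ℓ) :=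
  ⟨fun v w => ∃ s ∈ Sgrp ℓ i, (s : ZMod ℓ) • v.1 = w.1, by
    constructor
    · exact fun v => ⟨1, one_mem _, by rw [Units.val_one, one_smul]⟩
    · rintro v w ⟨s, hs, hsv⟩
      exact ⟨s⁻¹, inv_mem hs, by
        rw [← hsv, smul_smul, ← Units.val_mul, inv_mul_cancel, Units.val_one, one_smul]⟩
    · rintro u v w ⟨s, hs, hsu⟩ ⟨t, ht, htv⟩
      exact ⟨t * s, mul_mem ht hs, by rw [← htv, ← hsu, smul_smul, Units.val_mul]⟩⟩

def Vq (ℓ i : ℕ) [Fact ℓ.Prime] : Type := Quotient (vSetoid ℓ i)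

def VqProj (ℓ i : ℕ) [Fact ℓ.Prime] : Vq ℓ (i + 1) → Vq ℓ i :=
  Quotient.lift (fun v => (Quotient.mk (vSetoid ℓ i) v : Vq ℓ i))
    (fun v w h => Quotient.sound (by
      obtain ⟨s, hs, hsv⟩ := h
      exact ⟨s, Sgrp_succ_le ℓ i hs, hsv⟩))

/-- The action of `GL₂(F_ℓ)` on `V = F_ℓ² ∖ {0}`. -/
def glAct (ℓ : ℕ) [Fact ℓ.Prime] (A : GL (Fin 2) (ZMod ℓ)) (v : Vset ℓ) : Vset ℓ :=
  ⟨(A : Matrix (Fin 2) (Fin 2) (ZMod ℓ)).mulVec v.1, by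
    intro h0
    apply v.2
    have := congrArg ((A⁻¹ : GL (Fin 2) (ZMod ℓ)) : Matrix (Fin 2) (Fin 2) (ZMod ℓ)).mulVec h0
    rwa [Matrix.mulVec_mulVec, ← Units.val_mul, inv_mul_cancel, Units.val_one,
      Matrix.one_mulVec, Matrix.mulVec_zero] at this⟩

/-- The induced action of `GL₂(F_ℓ)/S_i` on `V_i = V/S_i`. -/
def qAct (ℓ i : ℕ) [Fact ℓ.Prime] (g : GL (Fin 2) (ZMod ℓ) ⧸ ZS ℓ i) (x : Vq ℓ i) :
    Vq ℓ i :=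
  Quotient.liftOn' g
    (fun A => Quotient.lift
      (fun v => (Quotient.mk (vSetoid ℓ i) (glAct ℓ A v) : Vq ℓ i))
      (fun v w h => Quotient.sound (by
        obtain ⟨s, hs, hsv⟩ := h
        exact ⟨s, hs, by
          show (s : ZMod ℓ) • ((A : Matrix (Fin 2) (Fin 2) (ZMod ℓ)).mulVec v.1) = _
          rw [← Matrix.mulVec_smul, hsv]; rfl⟩)) x)
    (fun A B hAB => by
      induction x using Quotient.inductionOn with
      | h v => exact Quotient.sound (by
          rw [QuotientGroup.leftRel_apply] at hAB
          obtain ⟨s, hs, hmul⟩ := hAB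
          refine ⟨s, hs, ?_⟩
          have hB : B = A * scalarGL ℓ s := by rw [hmul, mul_inv_cancel_left]
          show (s : ZMod ℓ) • ((A : Matrix (Fin 2) (Fin 2) (ZMod ℓ)).mulVec v.1) =
            ((B : Matrix (Fin 2) (Fin 2) (ZMod ℓ)).mulVec v.1)
          have h1 : ((scalarGL ℓ s : GL (Fin 2) (ZMod ℓ)) :
              Matrix (Fin 2) (Fin 2) (ZMod ℓ)) =
              (s : ZMod ℓ) • (1 : Matrix (Fin 2) (Fin 2) (ZMod ℓ)) := by
            simp [scalarGL, Matrix.scalar, Matrix.smul_one_eq_diagonal]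
          rw [hB, Units.val_mul, h1, Matrix.mul_smul, mul_one,
            Matrix.smul_mulVec]))

/-- The diagonal matrix `diag(1, -1)` as an element of `GL₂(R)`. -/
def diagOneNegOne (R : Type*) [CommRing R] : GL (Fin 2) R :=
  ⟨Matrix.diagonal ![1, -1], Matrix.diagonal ![1, -1],
    by
      rw [Matrix.diagonal_mul_diagonal]
      convert Matrix.diagonal_one using 2
      funext i
      fin_cases i <;> simp,
    by
      rw [Matrix.diagonal_mul_diagonal]
      convert Matrix.diagonal_one using 2
      funext i
      fin_cases i <;> simp⟩

end

section Bruhat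
variable {F : Type*} [Field F]

/-- The diagonal matrix `diag(a, d)`. -/
def diagGL (a d : Fˣ) : GL (Fin 2) F :=
  ⟨!![(a : F), 0; 0, d], !![((a⁻¹ : Fˣ) : F), 0; 0, ((d⁻¹ : Fˣ) : F)],
    by simp [Matrix.one_fin_two], by simp [Matrix.one_fin_two]⟩

/-- The upper unipotent matrix with entry `t`. -/
def unipGL (t : F) : GL (Fin 2) F :=
  ⟨!![1, t; 0, 1], !![1, -t; 0, 1],
    by simp [Matrix.one_fin_two], by simp [Matrix.one_fin_two]⟩

/-- The permutation matrix exchanging the basis vectors. -/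
def swapGL : GL (Fin 2) F :=
  ⟨!![0, 1; 1, 0], !![0, 1; 1, 0],
    by simp [Matrix.one_fin_two], by simp [Matrix.one_fin_two]⟩

@[simp] lemma diagGL_val (a d : Fˣ) : (diagGL a d).val = !![(a : F), 0; 0, d] := rfl
@[simp] lemma unipGL_val (t : F) : (unipGL t).val = !![1, t; 0, 1] := rfl
@[simp] lemma swapGL_val : (swapGL : GL (Fin 2) F).val = !![0, 1; 1, 0] := rfl

lemma bruhat_decomposition (M : GL (Fin 2) F) :
    (∃ a d t, M = diagGL a d * unipGL t) ∨
      ∃ a d t u, M = diagGL a d * unipGL t * swapGL * unipGL u := by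
  obtain ⟨p, q, r, s, hM⟩ : ∃ p q r s, M.val = !![p, q; r, s] :=
    ⟨_, _, _, _, Matrix.eta_fin_two M.val⟩
  have hdet : p * s - q * r ≠ 0 := by
    have := (Matrix.GeneralLinearGroup.det M).ne_zero
    simpa [hM, Matrix.det_fin_two] using this
  by_cases hr : r = 0
  · subst hr
    have hp : p ≠ 0 := by rintro rfl; simp at hdet
    have hs : s ≠ 0 := by rintro rfl; simp at hdet
    refine Or.inl ⟨Units.mk0 p hp, Units.mk0 s hs, q / p, Units.ext ?_⟩
    simp [hM, mul_div_cancel₀ _ hp]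
  · have ha : q - p * s / r ≠ 0 := by
      intro h
      apply hdet
      field_simp at h
      linear_combination -h
    refine Or.inr ⟨Units.mk0 _ ha, Units.mk0 r hr, p / (q - p * s / r), s / r, Units.ext ?_⟩
    have h1 : (q - p * s / r) * (p / (q - p * s / r)) = p := mul_div_cancel₀ _ ha
    simp [hM, h1, mul_div_cancel₀ _ hr]
    ring

lemma swapGL_mul_diagGL (a d : Fˣ) : swapGL * diagGL a d * swapGL = diagGL d a :=
  Units.ext (by simp)

lemma diagGL_mul_diagGL (a d a' d' : Fˣ) :
    diagGL a d * diagGL a' d' = diagGL (a * a') (d * d') :=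
  Units.ext (by simp)

lemma unipGL_mul_unipGL (t u : F) : unipGL t * unipGL u = unipGL (t + u) :=
  Units.ext (by simp [add_comm])

lemma diagGL_one_one : (diagGL 1 1 : GL (Fin 2) F) = 1 :=
  Units.ext (by simp [Matrix.one_fin_two])

lemma unipGL_zero : (unipGL 0 : GL (Fin 2) F) = 1 :=
  Units.ext (by simp [Matrix.one_fin_two])

lemma subgroup_eq_top_of_bruhat (S : Subgroup (GL (Fin 2) F)) (hD : ∀ d, diagGL 1 d ∈ S)
    (hX : ∀ t, unipGL t ∈ S) (hw : swapGL ∈ S) : S = ⊤ := by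
  have hT (a d : Fˣ) : diagGL a d ∈ S := by
    have := S.mul_mem (S.mul_mem (S.mul_mem hw (hD a)) hw) (hD d)
    rwa [swapGL_mul_diagGL, diagGL_mul_diagGL, mul_one, one_mul] at this
  rw [eq_top_iff]
  rintro M -
  rcases bruhat_decomposition M with ⟨a, d, t, rfl⟩ | ⟨a, d, t, u, rfl⟩
  · exact S.mul_mem (hT _ _) (hX _)
  · exact S.mul_mem (S.mul_mem (S.mul_mem (hT _ _) (hX _)) hw) (hX _)

/-- When `2` is invertible, the swap matrix is conjugate to `diag(1, -1)`. -/
lemma exists_conj_swapGL (h2 : (2 : F) ≠ 0) :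
    ∃ g : GL (Fin 2) F, g * diagGL 1 (-1) = swapGL * g := by
  refine ⟨Matrix.GeneralLinearGroup.mkOfDetNeZero !![1, 1; 1, -1] ?_, Units.ext ?_⟩
  · rw [Matrix.det_fin_two_of]
    intro h
    apply h2
    linear_combination -h
  · simp [Matrix.GeneralLinearGroup.mkOfDetNeZero]

end Bruhat

/-- A nonsquare scalar matrix is a power of a matrix of nonsquare determinant. -/
lemma exists_pow_eq_scalar (ℓ : ℕ) [Fact ℓ.Prime] (hℓ : ℓ ≠ 2) (g : (ZMod ℓ)ˣ)
    (hg : ¬ IsSquare (g : ZMod ℓ)) :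
    ∃ γ : GL (Fin 2) (ZMod ℓ), γ ^ (ℓ + 1) = diagGL g g ∧
      Matrix.GeneralLinearGroup.det γ = g := by
  obtain ⟨p, q, hpq⟩ : ∃ p q : ZMod ℓ, p ^ 2 - g * q ^ 2 = g := by
    have hc : Fintype.card (ZMod ℓ) % 2 = 1 := by
      rw [ZMod.card]
      exact (Nat.Prime.eq_two_or_odd (Fact.out : ℓ.Prime)).resolve_left hℓ
    obtain ⟨p, q, h⟩ := FiniteField.exists_root_sum_quadratic
      (f := (X ^ 2 : (ZMod ℓ)[X])) (g := C (-(g : ZMod ℓ)) * X ^ 2 + C (-(g : ZMod ℓ)))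
      (by simp) (by compute_degree!) hc
    refine ⟨p, q, ?_⟩
    simp at h
    linear_combination h
  have hdet : p * p - (g * q) * q = g := by linear_combination hpq
  let γ : GL (Fin 2) (ZMod ℓ) := Matrix.GeneralLinearGroup.mkOfDetNeZero !![p, g * q; q, p]
    (by rw [Matrix.det_fin_two_of, hdet]; exact g.ne_zero)
  have hγ : γ.val = !![p, g * q; q, p] := rfl
  refine ⟨γ, Units.ext ?_, Units.ext ?_⟩
  · rw [Units.val_pow_eq_pow_val, hγ, pow_succ]
    let J : Matrix (Fin 2) (Fin 2) (ZMod ℓ) := !![0, (g : ZMod ℓ); 1, 0]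
    have hJ2 : J ^ 2 = scalar (Fin 2) (g : ZMod ℓ) := by
      ext i j
      fin_cases i <;> fin_cases j <;> simp [J, pow_two]
    have hJ : J ^ ℓ = -J := by
      have hodd : Odd ℓ := (Fact.out : ℓ.Prime).odd_of_ne_two hℓ
      have h1 : ℓ = 2 * (ℓ / 2) + 1 := (Nat.two_mul_div_two_add_one_of_odd hodd).symm
      have h2 : (g : ZMod ℓ) ^ (ℓ / 2) = -1 := by
        rcases ZMod.pow_div_two_eq_neg_one_or_one ℓ g.ne_zero with h | h
        · exact absurd ((ZMod.euler_criterion ℓ g.ne_zero).2 h) hg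
        · exact h
      calc J ^ ℓ = J ^ (2 * (ℓ / 2) + 1) := congrArg (J ^ ·) h1
        _ = -J := by
          rw [pow_succ, pow_mul, hJ2, ← map_pow, h2, map_neg, map_one, neg_one_mul]
    have hdecomp : !![p, g * q; q, p] = scalar (Fin 2) p + scalar (Fin 2) q * J := by
      ext i j
      fin_cases i <;> fin_cases j <;> simp [J, mul_comm]
    have hcomm : Commute (scalar (Fin 2) q) J := Matrix.scalar_commute _ (fun _ => Commute.all _ _) _
    have hcomm' : Commute (scalar (Fin 2) p) (scalar (Fin 2) q * J) :=
      Matrix.scalar_commute _ (fun _ => Commute.all _ _) _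
    have hpow : !![p, g * q; q, p] ^ ℓ = scalar (Fin 2) p - scalar (Fin 2) q * J := by
      rw [hdecomp, add_pow_char_of_commute ℓ hcomm', hcomm.mul_pow, ← map_pow, ← map_pow,
        ZMod.pow_card, ZMod.pow_card, hJ]
      simp [sub_eq_add_neg]
    rw [hpow]
    ext i j
    fin_cases i <;> fin_cases j <;> simp [J, Matrix.mul_apply, Fin.sum_univ_two] <;>
      first | linear_combination hdet | ring
  · simp [hγ, Matrix.det_fin_two_of, hdet]

/-- An element commuting up to the central pair `{1, c}` defines a homomorphism
`e ↦ z e z⁻¹ e⁻¹`. -/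
def commutatorHom {E : Type*} [Group E] (z : E)
    (h : ∀ e f : E, Commute (z * e * z⁻¹ * e⁻¹) f) : E →* E where
  toFun e := z * e * z⁻¹ * e⁻¹
  map_one' := by group
  map_mul' e f := by
    have h1 := (h f e).eq
    calc z * (e * f) * z⁻¹ * (e * f)⁻¹
        = z * e * z⁻¹ * ((z * f * z⁻¹ * f⁻¹) * e⁻¹) := by group
      _ = z * e * z⁻¹ * (e⁻¹ * (z * f * z⁻¹ * f⁻¹)) := by rw [(h f e⁻¹).eq]
      _ = _ := by group

section Splitting

variable {E : Type*} [Group E] {ℓ : ℕ} [Fact ℓ.Prime]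

/-- A double cover of `GL₂(F_ℓ)`, with covering involution `c`. -/
structure IsDoubleCover (π : E →* GL (Fin 2) (ZMod ℓ)) (c : E) : Prop where
  surj : Function.Surjective π
  ne_one : c ≠ 1
  map_eq_one : ∀ e, π e = 1 ↔ e = 1 ∨ e = c

namespace IsDoubleCover

variable {π : E →* GL (Fin 2) (ZMod ℓ)} {c : E}

lemma map_c (h : IsDoubleCover π c) : π c = 1 := (h.map_eq_one c).2 (Or.inr rfl)

lemma comm (h : IsDoubleCover π c) (e : E) : Commute c e := by
  have h1 : π (e⁻¹ * c * e) = 1 := by simp [h.map_c]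
  rcases (h.map_eq_one _).1 h1 with h2 | h2
  · exfalso
    apply h.ne_one
    calc c = e * (e⁻¹ * c * e) * e⁻¹ := by group
      _ = 1 := by rw [h2]; group
  · calc c * e = e * (e⁻¹ * c * e) := by group
      _ = e * c := by rw [h2]

lemma mul_self (h : IsDoubleCover π c) : c * c = 1 := by
  have h1 : π (c * c) = 1 := by simp [h.map_c]
  rcases (h.map_eq_one _).1 h1 with h2 | h2
  · exact h2
  · exact absurd (mul_eq_left.1 h2) h.ne_one

lemma eq_or_of_map_eq (h : IsDoubleCover π c) {e f : E} (hef : π e = π f) :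
    e = f ∨ e = f * c := by
  have h1 : π (f⁻¹ * e) = 1 := by simp [hef]
  rcases (h.map_eq_one _).1 h1 with h2 | h2
  · exact Or.inl (inv_mul_eq_one.1 h2).symm
  · exact Or.inr (by rw [← h2]; group)

lemma commute_of_map_eq (h : IsDoubleCover π c) {e f x : E} (hef : π e = π f)
    (hf : Commute f x) : Commute e x := by
  rcases h.eq_or_of_map_eq hef with rfl | rfl
  · exact hf
  · exact hf.mul_left (h.comm x)

lemma sq_eq_of_map_eq (h : IsDoubleCover π c) {e f : E} (hef : π e = π f) : e * e = f * f := by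
  rcases h.eq_or_of_map_eq hef with rfl | rfl
  · rfl
  · rw [(h.comm f).eq.symm, mul_assoc, ← mul_assoc f, ← (h.comm f).eq, mul_assoc c,
      ← mul_assoc, h.mul_self, one_mul]

lemma sq_eq_one_of_map_eq_one (h : IsDoubleCover π c) {e : E} (he : π e = 1) : e * e = 1 := by
  rcases (h.map_eq_one _).1 he with rfl | rfl
  · simp
  · exact h.mul_self

lemma eq_top_of_mem (h : IsDoubleCover π c) (S : Subgroup E) (hc : c ∈ S)
    (hD : ∀ d, ∃ e ∈ S, π e = diagGL 1 d) (hX : ∀ t, ∃ e ∈ S, π e = unipGL t)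
    (hw : ∃ e ∈ S, π e = swapGL) : S = ⊤ := by
  have h1 : S.map π = ⊤ := subgroup_eq_top_of_bruhat _ hD hX hw
  rw [eq_top_iff]
  rintro e -
  obtain ⟨f, hf, hfe⟩ : π e ∈ S.map π := h1 ▸ Subgroup.mem_top _
  rcases h.eq_or_of_map_eq hfe.symm with rfl | rfl
  · exact hf
  · exact S.mul_mem hf hc

lemma commute_of_map_scalar (h : IsDoubleCover π c) (hℓ : ℓ ≠ 2) (D : (ZMod ℓ)ˣ →* E)
    (hD : ∀ d, π (D d) = diagGL 1 d) {z : E} {a : (ZMod ℓ)ˣ} (hz : π z = diagGL a a)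
    (x : E) : Commute z x := by
  have h2 : (2 : ZMod ℓ) ≠ 0 := by
    intro h
    have := (ZMod.natCast_eq_zero_iff 2 ℓ).1 (by exact_mod_cast h)
    exact hℓ ((Nat.prime_dvd_prime_iff_eq Fact.out Nat.prime_two).1 this)
  -- commutators with lifts of scalars are trivial in `GL₂`
  have hscal (z : E) (a : (ZMod ℓ)ˣ) (hz : π z = diagGL a a) (e : E) :
      π (z * e * z⁻¹ * e⁻¹) = 1 := by
    have : π z * π e = π e * π z := by
      rw [hz]
      exact Units.ext (by ext i j; fin_cases i <;> fin_cases j <;>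
        simp [Matrix.mul_apply, Fin.sum_univ_two, mul_comm])
    rw [map_mul, map_mul, map_mul, this, map_inv, map_inv, mul_assoc, mul_assoc,
      mul_inv_cancel_left, mul_inv_cancel]
  have hcen (z : E) (a : (ZMod ℓ)ˣ) (hz : π z = diagGL a a) (e f : E) :
      Commute (z * e * z⁻¹ * e⁻¹) f := by
    rcases (h.map_eq_one _).1 (hscal z a hz e) with h1 | h1
    · rw [h1]; exact Commute.one_left f
    · rw [h1]; exact h.comm f
  have hcomm_iff (z e : E) : Commute z e ↔ z * e * z⁻¹ * e⁻¹ = 1 := by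
    rw [mul_inv_eq_one, mul_inv_eq_iff_eq_mul]
    rfl
  by_cases hsq : IsSquare (a : ZMod ℓ)
  · obtain ⟨b, hb⟩ := hsq
    have hb0 : b ≠ 0 := by rintro rfl; exact a.ne_zero (by simp at hb)
    obtain ⟨y, hy⟩ := h.surj (diagGL (Units.mk0 b hb0) (Units.mk0 b hb0))
    have hyz : π z = π (y * y) := by
      rw [map_mul, hy, hz, diagGL_mul_diagGL]
      congr 1 <;> exact Units.ext hb
    refine h.commute_of_map_eq hyz ?_
    rw [hcomm_iff]
    have h3 := hcen y _ hy x
    have h4 := h.sq_eq_one_of_map_eq_one (hscal y _ hy x)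
    calc y * y * x * (y * y)⁻¹ * x⁻¹ = y * (y * x * y⁻¹ * x⁻¹) * (x * y⁻¹ * x⁻¹) := by group
      _ = (y * x * y⁻¹ * x⁻¹) * y * (x * y⁻¹ * x⁻¹) := by rw [(h3 y).eq]
      _ = (y * x * y⁻¹ * x⁻¹) * (y * x * y⁻¹ * x⁻¹) := by group
      _ = 1 := h4
  · let f := commutatorHom z (hcen z a hz)
    have hf_apply (e : E) : f e = z * e * z⁻¹ * e⁻¹ := rfl
    have hfcen (e g : E) : Commute (f e) g := hcen z a hz e g
    have hfsq (e : E) : f (e * e) = 1 := by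
      rw [map_mul]; exact h.sq_eq_one_of_map_eq_one (hscal z a hz e)
    have hfconj (e g : E) : f (e * g * e⁻¹) = f g := by
      rw [map_mul, map_mul, map_inv, (hfcen e (f g)).eq, mul_inv_cancel_right]
    have hfc : f c = 1 := by rw [hf_apply, ← hcomm_iff]; exact (h.comm z).symm
    let k : E →* E := (f.comp D).comp (Matrix.GeneralLinearGroup.det.comp π)
    have hk_apply (e : E) : k e = f (D (Matrix.GeneralLinearGroup.det (π e))) := rfl
    have htop : f.eqLocus k = ⊤ := by
      refine h.eq_top_of_mem _ ?_ (fun d => ⟨D d, ?_, hD d⟩) (fun t => ?_) ?_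
      · change f c = k c
        rw [hfc, hk_apply, h.map_c, map_one, map_one, map_one]
      · change f (D d) = k (D d)
        rw [hk_apply, hD]
        congr 2
        exact Units.ext (by simp [Matrix.det_fin_two])
      · obtain ⟨y, hy⟩ := h.surj (unipGL (t / 2))
        refine ⟨y * y, ?_, ?_⟩
        · change f _ = k _
          rw [hfsq, hk_apply, map_mul, hy]
          have : Matrix.GeneralLinearGroup.det (unipGL (t / 2) * unipGL (t / 2)) = 1 :=
            Units.ext (by simp [Matrix.det_fin_two])
          rw [this, map_one, map_one]
        · rw [map_mul, hy, unipGL_mul_unipGL]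
          congr 1
          field_simp
          norm_num
      · obtain ⟨g, hg⟩ := exists_conj_swapGL h2
        obtain ⟨y, rfl⟩ := h.surj g
        have hy : π (y * D (-1) * y⁻¹) = swapGL := by
          rw [map_mul, map_mul, hD, hg, map_inv, mul_inv_cancel_right]
        refine ⟨y * D (-1) * y⁻¹, ?_, hy⟩
        change f _ = k _
        rw [hfconj, hk_apply, hy]
        congr 2
        exact Units.ext (by simp [Matrix.det_fin_two])
    have hfk (e : E) : f e = k e := by
      have : e ∈ f.eqLocus k := htop ▸ Subgroup.mem_top e
      exact this
    obtain ⟨γ, hγ, hdet⟩ := exists_pow_eq_scalar ℓ hℓ a hsq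
    obtain ⟨y, rfl⟩ := h.surj γ
    have hfy : f y = 1 := by
      rw [hf_apply, ← hcomm_iff]
      refine h.commute_of_map_eq (f := y ^ (ℓ + 1)) (by rw [map_pow, hγ, hz]) ?_
      exact (Commute.refl y).pow_left _
    have hfa : f (D a) = 1 := by rw [← hdet, ← hk_apply, ← hfk, hfy]
    have hfD (d : (ZMod ℓ)ˣ) : f (D d) = 1 := by
      by_cases hd : IsSquare (d : ZMod ℓ)
      · obtain ⟨b, hb⟩ := hd
        have hb0 : b ≠ 0 := by rintro rfl; exact d.ne_zero (by simp at hb)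
        have : d = Units.mk0 b hb0 * Units.mk0 b hb0 := Units.ext hb
        rw [this, map_mul, hfsq]
      · have hsq' : IsSquare ((d * a : (ZMod ℓ)ˣ) : ZMod ℓ) := by
          rw [ZMod.euler_criterion ℓ (Units.ne_zero _), Units.val_mul, mul_pow]
          rw [ZMod.euler_criterion ℓ (Units.ne_zero _)] at hd hsq
          rw [(ZMod.pow_div_two_eq_neg_one_or_one ℓ d.ne_zero).resolve_left hd,
            (ZMod.pow_div_two_eq_neg_one_or_one ℓ a.ne_zero).resolve_left hsq]
          norm_num
        obtain ⟨b, hb⟩ := hsq'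
        have hb0 : b ≠ 0 := by rintro rfl; exact (d * a).ne_zero (by simp at hb)
        have : d * a = Units.mk0 b hb0 * Units.mk0 b hb0 := Units.ext hb
        have h5 : f (D (d * a)) = 1 := by rw [this, map_mul, hfsq]
        rwa [map_mul, map_mul, hfa, mul_one] at h5
    rw [hcomm_iff, ← hf_apply, hfk, hk_apply, hfD]


lemma exists_splitting_of_lifts (h : IsDoubleCover π c) (hℓ : ℓ ≠ 2) (D : (ZMod ℓ)ˣ →* E)
    (hD : ∀ d, π (D d) = diagGL 1 d) (X : ZMod ℓ → E) (hX : ∀ t, π (X t) = unipGL t)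
    (hXadd : ∀ t u, X t * X u = X (t + u))
    (hDX : ∀ (d : (ZMod ℓ)ˣ) (t : ZMod ℓ), X t * D d = D d * X (t * d)) :
    ∃ S : Subgroup E, (∀ d, D d ∈ S) ∧ (∀ t, X t ∈ S) ∧ c ∉ S ∧ S.map π = ⊤ := by
  have h2 : (2 : ZMod ℓ) ≠ 0 := by
    intro h
    have := (ZMod.natCast_eq_zero_iff 2 ℓ).1 (by exact_mod_cast h)
    exact hℓ ((Nat.prime_dvd_prime_iff_eq Fact.out Nat.prime_two).1 this)
  have hX0 : X 0 = 1 := by simpa using hXadd 0 0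
  have hww (w : E) (hw : π w = swapGL) : w * w = 1 := by
    obtain ⟨g, hg⟩ := exists_conj_swapGL h2
    obtain ⟨y, rfl⟩ := h.surj g
    have hy : π w = π (y * D (-1) * y⁻¹) := by
      rw [map_mul, map_mul, hD, hg, map_inv, mul_inv_cancel_right, hw]
    rw [h.sq_eq_of_map_eq hy]
    calc y * D (-1) * y⁻¹ * (y * D (-1) * y⁻¹) = y * (D (-1) * D (-1)) * y⁻¹ := by group
      _ = 1 := by rw [← map_mul]; simp
  obtain ⟨w, hw, hwX⟩ : ∃ w, π w = swapGL ∧ w * X 1 * w = X 1 * w * D (-1) * X 1 := by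
    obtain ⟨w, hw⟩ := h.surj swapGL
    have h1 : π (w * X 1 * w) = π (X 1 * w * D (-1) * X 1) := by
      simp only [map_mul, hw, hX, hD]
      exact Units.ext (by simp)
    rcases h.eq_or_of_map_eq h1 with h3 | h3
    · exact ⟨w, hw, h3⟩
    · refine ⟨w * c, by rw [map_mul, h.map_c, mul_one, hw], ?_⟩
      have hc (e : E) : c * e = e * c := (h.comm e).eq
      calc w * c * X 1 * (w * c) = w * (c * X 1) * w * c := by group
        _ = w * X 1 * (c * w) * c := by rw [hc]; group
        _ = w * X 1 * w * (c * c) := by rw [hc w]; group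
        _ = X 1 * w * (D (-1) * X 1 * c) := by rw [h.mul_self, mul_one, h3]; group
        _ = X 1 * w * (c * (D (-1) * X 1)) := by rw [hc (D (-1) * X 1)]
        _ = _ := by group
  have hw2 := hww w hw
  have hπz (a : (ZMod ℓ)ˣ) : π (w * D a * w * D a) = diagGL a a := by
    simp only [map_mul, hw, hD]
    rw [swapGL_mul_diagGL, diagGL_mul_diagGL, mul_one, one_mul]
  have hzc (a : (ZMod ℓ)ˣ) (x : E) : Commute (w * D a * w * D a) x :=
    h.commute_of_map_scalar hℓ D hD (hπz a) x
  let z : (ZMod ℓ)ˣ →* E :=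
    { toFun := fun a => w * D a * w * D a
      map_one' := by simp [hw2]
      map_mul' := fun a b => by
        calc w * D (a * b) * w * D (a * b) = w * D a * (1 * D b) * w * D (b * a) := by
              rw [map_mul, mul_comm b a, map_mul]; group
          _ = w * D a * w * (w * D b * w * D b) * D a := by
              rw [← hw2, map_mul]; group
          _ = w * D a * w * (D a * (w * D b * w * D b)) := by rw [← (hzc b (D a)).eq]; group
          _ = _ := by group }
  have hz_apply (a : (ZMod ℓ)ˣ) : z a = w * D a * w * D a := rfl
  have hzcomm (a : (ZMod ℓ)ˣ) (x : E) : x * z a = z a * x := ((hzc a x).eq).symm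
  have hwD (a : (ZMod ℓ)ˣ) : w * D a = z a * D a⁻¹ * w := by
    rw [hz_apply, mul_assoc _ (D a), ← map_mul, mul_inv_cancel, map_one, mul_one, mul_assoc,
      hw2, mul_one]
  have hwXw (t : (ZMod ℓ)ˣ) :
      w * X t * w = z (-t⁻¹) * D (t * -t) * X (-t) * w * X ((t⁻¹ : (ZMod ℓ)ˣ) : ZMod ℓ) := by
    have hXt : X t = D t⁻¹ * X 1 * D t := by
      rw [mul_assoc, hDX, one_mul, ← mul_assoc, ← map_mul, inv_mul_cancel, map_one, one_mul]
    have hDw : D t * w = w * z t * D t⁻¹ := by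
      have := hwD t⁻¹
      rw [inv_inv] at this
      have hz1 : z t * (z t⁻¹ * D t * w) = D t * w := by
        rw [← mul_assoc, ← mul_assoc, ← map_mul, mul_inv_cancel, map_one, one_mul]
      rw [hzcomm, mul_assoc, this, hz1]
    calc w * X t * w = w * D t⁻¹ * X 1 * (D t * w) := by rw [hXt]; group
      _ = z t⁻¹ * D t * (w * X 1 * w) * z t * D t⁻¹ := by rw [hwD, hDw, inv_inv]; group
      _ = z t⁻¹ * z t * (D t * (w * X 1 * w)) * D t⁻¹ := by
        rw [mul_assoc (z t⁻¹) (D t), mul_assoc (z t⁻¹), hzcomm t]; group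
      _ = D t * X 1 * w * D (-1) * (X 1 * D t⁻¹) := by
        rw [← map_mul, inv_mul_cancel, map_one, hwX]; group
      _ = D t * X 1 * (w * D (-t⁻¹)) * X ((t⁻¹ : (ZMod ℓ)ˣ) : ZMod ℓ) := by
        rw [hDX, one_mul, ← neg_one_mul t⁻¹, map_mul]; group
      _ = D t * X 1 * z (-t⁻¹) * D (-t) * w * X ((t⁻¹ : (ZMod ℓ)ˣ) : ZMod ℓ) := by
        rw [hwD, inv_neg, inv_inv]; group
      _ = z (-t⁻¹) * D t * (X 1 * D (-t)) * w * X ((t⁻¹ : (ZMod ℓ)ˣ) : ZMod ℓ) := by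
        rw [hzcomm]; group
      _ = _ := by
        rw [hDX, one_mul, Units.val_neg, map_mul]; group
  -- the Bruhat cells
  let T : Set E := {x | (∃ a d t, x = z a * D d * X t) ∨
    ∃ a d t u, x = z a * D d * X t * w * X u}
  have hTX {x : E} (hx : x ∈ T) (v : ZMod ℓ) : x * X v ∈ T := by
    rcases hx with ⟨a, d, t, rfl⟩ | ⟨a, d, t, u, rfl⟩
    · exact Or.inl ⟨a, d, t + v, by rw [← hXadd]; group⟩
    · exact Or.inr ⟨a, d, t, u + v, by rw [← hXadd]; group⟩
  have hTD {x : E} (hx : x ∈ T) (e : (ZMod ℓ)ˣ) : x * D e ∈ T := by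
    rcases hx with ⟨a, d, t, rfl⟩ | ⟨a, d, t, u, rfl⟩
    · exact Or.inl ⟨a, d * e, t * e, by rw [mul_assoc, hDX, map_mul]; group⟩
    · refine Or.inr ⟨a * e, d * e⁻¹, t * ((e⁻¹ : (ZMod ℓ)ˣ) : ZMod ℓ), u * e, ?_⟩
      calc z a * D d * X t * w * X u * D e = z a * D d * X t * (w * D e) * X (u * e) := by
            rw [mul_assoc _ (X u), hDX]; group
        _ = z a * (D d * X t * z e) * D e⁻¹ * w * X (u * e) := by rw [hwD]; group
        _ = z a * z e * D d * (X t * D e⁻¹) * w * X (u * e) := by rw [hzcomm]; group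
        _ = _ := by rw [hDX, map_mul, map_mul]; group
  have hTw {x : E} (hx : x ∈ T) : x * w ∈ T := by
    rcases hx with ⟨a, d, t, rfl⟩ | ⟨a, d, t, u, rfl⟩
    · exact Or.inr ⟨a, d, t, 0, by rw [hX0, mul_one]⟩
    · by_cases hu : u = 0
      · exact Or.inl ⟨a, d, t, by rw [hu, hX0, mul_one, mul_assoc, hw2, mul_one]⟩
      · obtain ⟨u, rfl⟩ : IsUnit u := Ne.isUnit hu
        refine Or.inr ⟨a * -u⁻¹, d * (u * -u), t * ((u * -u : (ZMod ℓ)ˣ) : ZMod ℓ) + -u,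
          ((u⁻¹ : (ZMod ℓ)ˣ) : ZMod ℓ), ?_⟩
        calc z a * D d * X t * w * X u * w = z a * D d * X t * (w * X u * w) := by group
          _ = z a * (D d * X t * z (-u⁻¹)) * D (u * -u) * X (-u) * w *
              X ((u⁻¹ : (ZMod ℓ)ˣ) : ZMod ℓ) := by rw [hwXw]; group
          _ = z a * z (-u⁻¹) * D d * (X t * D (u * -u)) * X (-u) * w *
              X ((u⁻¹ : (ZMod ℓ)ˣ) : ZMod ℓ) := by rw [hzcomm]; group
          _ = _ := by rw [hDX, ← hXadd, map_mul z, map_mul D d]; group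
  have hT1 : (1 : E) ∈ T := Or.inl ⟨1, 1, 0, by rw [hX0]; simp⟩
  have hXinv (t : ZMod ℓ) : (X t)⁻¹ = X (-t) := by
    rw [inv_eq_iff_mul_eq_one, hXadd, add_neg_cancel, hX0]
  let G : Set E := Set.range D ∪ Set.range X ∪ {w}
  have hDS (d) : D d ∈ Subgroup.closure G :=
    Subgroup.subset_closure (Or.inl (Or.inl ⟨d, rfl⟩))
  have hXS (t) : X t ∈ Subgroup.closure G :=
    Subgroup.subset_closure (Or.inl (Or.inr ⟨t, rfl⟩))
  have hwS : w ∈ Subgroup.closure G := Subgroup.subset_closure (Or.inr rfl)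
  have hST (x : E) (hx : x ∈ Subgroup.closure G) : x ∈ T := by
    induction hx using Subgroup.closure_induction_right with
    | one => exact hT1
    | mul_right x hx y hy ih =>
      rcases hy with (⟨d, rfl⟩ | ⟨t, rfl⟩) | rfl
      exacts [hTD ih d, hTX ih t, hTw ih]
    | mul_inv_cancel x hx y hy ih =>
      rcases hy with (⟨d, rfl⟩ | ⟨t, rfl⟩) | rfl
      · rw [← map_inv]; exact hTD ih _
      · rw [hXinv]; exact hTX ih _
      · rw [inv_eq_of_mul_eq_one_left hw2]; exact hTw ih
  refine ⟨Subgroup.closure G, hDS, hXS, fun hc => ?_, ?_⟩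
  · rcases hST c hc with ⟨a, d, t, hcT⟩ | ⟨a, d, t, u, hcT⟩
    · have h4 := congrArg (fun e => (π e).val) hcT
      simp only [h.map_c, map_mul, hz_apply, hw, hD, hX, swapGL_mul_diagGL] at h4
      have h00 := congrFun (congrFun h4 0) 0
      have h01 := congrFun (congrFun h4 0) 1
      have h11 := congrFun (congrFun h4 1) 1
      simp at h00 h01 h11
      have ha : a = 1 := Units.ext h00.symm
      subst ha
      have hd : d = 1 := Units.ext (by simpa using h11.symm)
      subst hd
      obtain rfl : t = 0 := by simpa using h01
      exact h.ne_one (by rw [hcT, hX0]; simp)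
    · have h4 := congrArg (fun e => (π e).val) hcT
      simp only [h.map_c, map_mul, hz_apply, hw, hD, hX, swapGL_mul_diagGL] at h4
      have h10 := congrFun (congrFun h4 1) 0
      simp at h10
  · exact subgroup_eq_top_of_bruhat _ (fun d => ⟨D d, hDS d, hD d⟩)
      (fun t => ⟨X t, hXS t, hX t⟩) ⟨w, hwS, hw⟩

/-- A double cover of `GL₂(F_ℓ)` that splits over the stabilizer of the first basis vector
splits. -/
lemma exists_splitting (h : IsDoubleCover π c) (hℓ : ℓ ≠ 2) (H : Subgroup E) (hcH : c ∉ H)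
    (hH : ∀ d t, diagGL 1 d * unipGL t ∈ H.map π)
    (hH' : ∀ e ∈ H, ∃ d t, π e = diagGL 1 d * unipGL t) :
    ∃ S : Subgroup E, H ≤ S ∧ c ∉ S ∧ S.map π = ⊤ := by
  have huniq {e f : E} (he : e ∈ H) (hf : f ∈ H) (hef : π e = π f) : e = f := by
    rcases h.eq_or_of_map_eq hef with rfl | rfl
    · rfl
    · exact absurd ((H.mul_mem_cancel_left hf).1 he) hcH
  have hHD (d : (ZMod ℓ)ˣ) : ∃ e ∈ H, π e = diagGL 1 d := by
    obtain ⟨e, he, h1⟩ := hH d 0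
    exact ⟨e, he, by rw [h1, unipGL_zero, mul_one]⟩
  have hHX (t : ZMod ℓ) : ∃ e ∈ H, π e = unipGL t := by
    obtain ⟨e, he, h1⟩ := hH 1 t
    exact ⟨e, he, by rw [h1, diagGL_one_one, one_mul]⟩
  choose D hDH hD using hHD
  choose X hXH hX using hHX
  let D' : (ZMod ℓ)ˣ →* E := MonoidHom.mk' D fun a b =>
    huniq (hDH _) (H.mul_mem (hDH _) (hDH _)) (by
      rw [map_mul, hD, hD, hD, diagGL_mul_diagGL, mul_one])
  have hDX (d : (ZMod ℓ)ˣ) (t : ZMod ℓ) : X t * D' d = D' d * X (t * d) :=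
    huniq (H.mul_mem (hXH _) (hDH _)) (H.mul_mem (hDH _) (hXH _)) (by
      have : π (D' d) = diagGL 1 d := hD d
      rw [map_mul, map_mul, hX, hX, this]
      exact Units.ext (by simp))
  obtain ⟨S, hSD, hSX, hcS, hS⟩ := h.exists_splitting_of_lifts hℓ D' hD X hX
    (fun t u => huniq (H.mul_mem (hXH _) (hXH _)) (hXH _) (by
      rw [map_mul, hX, hX, hX, unipGL_mul_unipGL])) hDX
  refine ⟨S, fun e he => ?_, hcS, hS⟩
  obtain ⟨d, t, hdt⟩ := hH' e he
  have : e = D d * X t := huniq he (H.mul_mem (hDH _) (hXH _)) (by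
    rw [hdt, map_mul, hD, hX])
  rw [this]
  exact S.mul_mem (hSD d) (hSX t)

end IsDoubleCover
end Splitting

section Step

variable {ℓ : ℕ} [Fact ℓ.Prime]

/-- The class in `V_i` of a nonzero vector. -/
def vClass (ℓ i : ℕ) [Fact ℓ.Prime] (v : Vset ℓ) : Vq ℓ i := Quotient.mk (vSetoid ℓ i) v

lemma qAct_mk (i : ℕ) (A : GL (Fin 2) (ZMod ℓ)) (v : Vset ℓ) :
    qAct ℓ i (QuotientGroup.mk A) (vClass ℓ i v) = vClass ℓ i (glAct ℓ A v) := rfl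

lemma vClass_eq_iff (i : ℕ) (v w : Vset ℓ) :
    vClass ℓ i v = vClass ℓ i w ↔ ∃ s ∈ Sgrp ℓ i, (s : ZMod ℓ) • v.1 = w.1 :=
  Quotient.eq (r := vSetoid ℓ i)

lemma scalarGL_val_mulVec (s : (ZMod ℓ)ˣ) (v : Fin 2 → ZMod ℓ) :
    (scalarGL ℓ s).val.mulVec v = (s : ZMod ℓ) • v := by
  have h1 : (scalarGL ℓ s).val = (s : ZMod ℓ) • (1 : Matrix (Fin 2) (Fin 2) (ZMod ℓ)) := by
    simp [scalarGL, Matrix.scalar, Matrix.smul_one_eq_diagonal]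
  rw [h1, Matrix.smul_mulVec, Matrix.one_mulVec]

lemma scalarGL_injective : Function.Injective (scalarGL ℓ) := by
  intro s t h
  have := congrArg (fun A : GL (Fin 2) (ZMod ℓ) => A.val 0 0) h
  exact Units.ext (by simpa [scalarGL] using this)

lemma scalarGL_mem_ZS {i : ℕ} {s : (ZMod ℓ)ˣ} : scalarGL ℓ s ∈ ZS ℓ i ↔ s ∈ Sgrp ℓ i := by
  constructor
  · rintro ⟨t, ht, hts⟩
    rwa [← scalarGL_injective hts]
  · exact fun h => ⟨s, h, rfl⟩

lemma qAct_mk_eq_self_iff (i : ℕ) (A : GL (Fin 2) (ZMod ℓ)) (v : Vset ℓ) :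
    qAct ℓ i (QuotientGroup.mk A) (vClass ℓ i v) = vClass ℓ i v ↔
      ∃ s ∈ Sgrp ℓ i, (scalarGL ℓ s * A).val.mulVec v.1 = v.1 := by
  rw [qAct_mk, vClass_eq_iff]
  simp only [Units.val_mul, ← Matrix.mulVec_mulVec, scalarGL_val_mulVec]
  rfl

lemma qAct_one (i : ℕ) (x : Vq ℓ i) : qAct ℓ i 1 x = x := by
  induction x using Quotient.inductionOn with
  | h v => exact congrArg (vClass ℓ i) (Subtype.ext (Matrix.one_mulVec v.1))

lemma qAct_mul (i : ℕ) (g h : GL (Fin 2) (ZMod ℓ) ⧸ ZS ℓ i) (x : Vq ℓ i) :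
    qAct ℓ i (g * h) x = qAct ℓ i g (qAct ℓ i h x) := by
  induction x using Quotient.inductionOn with
  | h v =>
    induction g using QuotientGroup.induction_on with
    | H A =>
      induction h using QuotientGroup.induction_on with
      | H B => exact congrArg (vClass ℓ i) (Subtype.ext (Matrix.mulVec_mulVec v.1 A.val B.val).symm)

/-- `GL₂` acts transitively on nonzero vectors. -/
lemma exists_mulVec_eq (v : Vset ℓ) :
    ∃ M : GL (Fin 2) (ZMod ℓ), M.val.mulVec ![1, 0] = v.1 := by
  obtain ⟨v, hv⟩ := v
  by_cases h0 : v 0 = 0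
  · have h1 : v 1 ≠ 0 := fun h1 => hv (by ext j; fin_cases j <;> simp [h0, h1])
    refine ⟨Matrix.GeneralLinearGroup.mkOfDetNeZero !![v 0, 1; v 1, 0] ?_, ?_⟩
    · simpa [Matrix.det_fin_two_of] using h1
    · ext j
      fin_cases j <;> simp [Matrix.GeneralLinearGroup.mkOfDetNeZero, Matrix.mulVec, dotProduct]
  · refine ⟨Matrix.GeneralLinearGroup.mkOfDetNeZero !![v 0, 0; v 1, 1] ?_, ?_⟩
    · simpa [Matrix.det_fin_two_of] using h0
    · ext j
      fin_cases j <;> simp [Matrix.GeneralLinearGroup.mkOfDetNeZero, Matrix.mulVec, dotProduct]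

lemma exists_qAct_eq (i : ℕ) (x y : Vq ℓ i) : ∃ g, qAct ℓ i g x = y := by
  induction x using Quotient.inductionOn with
  | h v =>
    induction y using Quotient.inductionOn with
    | h w =>
      obtain ⟨M, hM⟩ := exists_mulVec_eq v
      obtain ⟨M', hM'⟩ := exists_mulVec_eq w
      refine ⟨QuotientGroup.mk (M' * M⁻¹), congrArg (vClass ℓ i) (Subtype.ext ?_)⟩
      change (M' * M⁻¹).val.mulVec v.1 = w.1
      rw [← hM, Matrix.mulVec_mulVec, ← Units.val_mul, inv_mul_cancel_right, hM']

lemma mulVec_eq_self_iff (A : GL (Fin 2) (ZMod ℓ)) :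
    A.val.mulVec ![1, 0] = ![1, 0] ↔ ∃ d t, A = diagGL 1 d * unipGL t := by
  constructor
  · intro h
    have h0 : A.val 0 0 = 1 := by simpa [Matrix.mulVec, dotProduct] using congrFun h 0
    have h1 : A.val 1 0 = 0 := by simpa [Matrix.mulVec, dotProduct] using congrFun h 1
    have hdet : A.val 1 1 ≠ 0 := by
      intro h2
      apply (Matrix.GeneralLinearGroup.det A).ne_zero
      simp [Matrix.det_fin_two, h1, h2]
    refine ⟨Units.mk0 _ hdet, A.val 0 1, Units.ext ?_⟩
    conv_lhs => rw [Matrix.eta_fin_two A.val, h0, h1]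
    simp
  · rintro ⟨d, t, rfl⟩
    ext j
    fin_cases j <;> simp [Matrix.mulVec, dotProduct]

/-- A double cover of `GL₂(F_ℓ)` that splits over the stabilizer of a nonzero vector splits. -/
lemma IsDoubleCover.exists_splitting_of_stabilizer {E : Type*} [Group E]
    {π : E →* GL (Fin 2) (ZMod ℓ)} {c : E} (h : IsDoubleCover π c) (hℓ : ℓ ≠ 2)
    (v : Vset ℓ) (H : Subgroup E) (hcH : c ∉ H)
    (hH : ∀ A : GL (Fin 2) (ZMod ℓ), A ∈ H.map π ↔ A.val.mulVec v.1 = v.1) :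
    ∃ S : Subgroup E, H ≤ S ∧ c ∉ S ∧ S.map π = ⊤ := by
  obtain ⟨M, hM⟩ := exists_mulVec_eq v
  have hM' : M⁻¹.val.mulVec v.1 = ![1, 0] := by
    rw [← hM, Matrix.mulVec_mulVec, ← Units.val_mul, inv_mul_cancel, Units.val_one,
      Matrix.one_mulVec]
  let π' : E →* GL (Fin 2) (ZMod ℓ) := (MulAut.conj M⁻¹).toMonoidHom.comp π
  have hπ' (e : E) : π' e = M⁻¹ * π e * M := by simp [π']
  have hcover : IsDoubleCover π' c :=
    ⟨(MulAut.conj M⁻¹).surjective.comp h.surj, h.ne_one, fun e => by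
      rw [← h.map_eq_one e]
      exact map_eq_one_iff (MulAut.conj M⁻¹) (MulAut.conj M⁻¹).injective⟩
  obtain ⟨S, hHS, hcS, hS⟩ := hcover.exists_splitting hℓ H hcH
    (fun d t => by
      have h1 : M * (diagGL 1 d * unipGL t) * M⁻¹ ∈ H.map π := by
        rw [hH, Units.val_mul, ← Matrix.mulVec_mulVec, hM', Units.val_mul,
          ← Matrix.mulVec_mulVec, (mulVec_eq_self_iff _).2 ⟨d, t, rfl⟩, hM]
      obtain ⟨e, he, heq⟩ := h1
      exact ⟨e, he, by rw [hπ', heq]; group⟩)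
    (fun e he => by
      have h1 := (hH (π e)).1 ⟨e, he, rfl⟩
      rw [hπ', ← mulVec_eq_self_iff, Units.val_mul, ← Matrix.mulVec_mulVec, hM, Units.val_mul,
          ← Matrix.mulVec_mulVec, h1, hM'])
  refine ⟨S, hHS, hcS, ?_⟩
  rw [eq_top_iff]
  rintro A -
  obtain ⟨e, he, heq⟩ : M⁻¹ * A * M ∈ S.map π' := hS ▸ Subgroup.mem_top _
  refine ⟨e, he, ?_⟩
  rw [hπ'] at heq
  exact mul_left_cancel (mul_right_cancel heq)

lemma mul_mem_Sgrp_succ {i : ℕ} {s t : (ZMod ℓ)ˣ} (hs : s ∈ Sgrp ℓ i)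
    (ht : t ∈ Sgrp ℓ i) (hs' : s ∉ Sgrp ℓ (i + 1)) (ht' : t ∉ Sgrp ℓ (i + 1)) :
    s * t ∈ Sgrp ℓ (i + 1) := by
  have hkey (y : (ZMod ℓ)ˣ) (hy : IsSquare (y : ZMod ℓ)) : y ^ 2 ^ i ∈ Sgrp ℓ (i + 1) := by
    obtain ⟨b, hb⟩ := hy
    have hb0 : b ≠ 0 := by rintro rfl; exact y.ne_zero (by simp at hb)
    refine ⟨Units.mk0 b hb0, ?_⟩
    have : y = Units.mk0 b hb0 ^ 2 := Units.ext (by rw [hb, pow_two]; rfl)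
    rw [powMonoidHom_apply, this, ← pow_mul, pow_succ']
  obtain ⟨y, rfl⟩ := hs
  obtain ⟨z, rfl⟩ := ht
  simp only [powMonoidHom_apply] at *
  rw [← mul_pow]
  have hy := mt (hkey y) hs'
  have hz := mt (hkey z) ht'
  apply hkey
  rw [ZMod.euler_criterion ℓ (Units.ne_zero _)] at hy hz ⊢
  rw [Units.val_mul, mul_pow,
    (ZMod.pow_div_two_eq_neg_one_or_one ℓ y.ne_zero).resolve_left hy,
    (ZMod.pow_div_two_eq_neg_one_or_one ℓ z.ne_zero).resolve_left hz]
  norm_num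

/-- A lift of `Γ → GL₂(F_ℓ)/S_i` to `GL₂(F_ℓ)/S_{i+1}`. -/
lemma exists_lift_to_succ {Γ : Type*} [Group Γ] (hℓ : ℓ ≠ 2) (i : ℕ)
    (Ψ : Γ →* GL (Fin 2) (ZMod ℓ) ⧸ ZS ℓ i) (hΨ : Function.Surjective Ψ)
    (v : Vset ℓ) (N' H' : Subgroup Γ) [hN'n : N'.Normal] (hN' : N' = Ψ.ker ⊓ H')
    (hstab : ∀ σ ∈ H', qAct ℓ i (Ψ σ) (vClass ℓ i v) = vClass ℓ i v)
    (hidx : ∀ σ τ, qAct ℓ i (Ψ σ) (vClass ℓ i v) = vClass ℓ i v →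
      qAct ℓ i (Ψ τ) (vClass ℓ i v) = vClass ℓ i v → σ ∉ H' → τ ∉ H' → σ * τ ∈ H')
    (hne : ¬ Ψ.ker ≤ H') (hchar : ∀ J : Subgroup Γ, J.index = 2 → N' ≤ J → Ψ.ker ≤ J) :
    ∃ Ψ' : Γ →* GL (Fin 2) (ZMod ℓ) ⧸ ZS ℓ (i + 1), Function.Surjective Ψ' ∧ Ψ'.ker = N' ∧
      (∀ σ, projQ ℓ (i + 1) (Ψ' σ) = projQ ℓ i (Ψ σ)) ∧
      ∀ σ, σ ∈ H' ↔ qAct ℓ (i + 1) (Ψ' σ) (vClass ℓ (i + 1) v) = vClass ℓ (i + 1) v := by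
  have hN'ker : N' ≤ Ψ.ker := hN' ▸ inf_le_left
  have hN'H : N' ≤ H' := hN' ▸ inf_le_right
  obtain ⟨n, hnker, hnH⟩ := SetLike.not_le_iff_exists.1 hne
  have hker_stab {σ : Γ} (hσ : σ ∈ Ψ.ker) :
      qAct ℓ i (Ψ σ) (vClass ℓ i v) = vClass ℓ i v := by
    rw [MonoidHom.mem_ker.1 hσ, qAct_one]
  let q : Γ →* Γ ⧸ N' := QuotientGroup.mk' N'
  have hq : Function.Surjective q := QuotientGroup.mk'_surjective N'
  have hqker {σ : Γ} : q σ = 1 ↔ σ ∈ N' := QuotientGroup.eq_one_iff σ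
  let Ψq : Γ ⧸ N' →* GL (Fin 2) (ZMod ℓ) ⧸ ZS ℓ i := QuotientGroup.lift N' Ψ hN'ker
  have hΨq (σ : Γ) : Ψq (q σ) = Ψ σ := rfl
  have hqH {σ : Γ} : q σ ∈ H'.map q ↔ σ ∈ H' := by
    constructor
    · rintro ⟨τ, hτ, h⟩
      have : τ⁻¹ * σ ∈ N' := by rw [← hqker, map_mul, map_inv, h, inv_mul_cancel]
      simpa using H'.mul_mem hτ (hN'H this)
    · exact fun h => ⟨σ, h, rfl⟩
  have hc1 : q n ≠ 1 := fun h => hnH (hN'H (hqker.1 h))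
  have hΨc : Ψq (q n) = 1 := hnker
  -- the kernel of `Ψq` has order two
  have hker2 (e : Γ ⧸ N') (he : Ψq e = 1) : e = 1 ∨ e = q n := by
    obtain ⟨σ, rfl⟩ := hq e
    by_cases hσ : σ ∈ H'
    · exact Or.inl (hqker.2 (hN' ▸ ⟨he, hσ⟩))
    · right
      have h1 : σ⁻¹ ∉ H' := fun h => hσ (by simpa using H'.inv_mem h)
      have h2 := hidx σ⁻¹ n (hker_stab (Ψ.ker.inv_mem he)) (hker_stab hnker) h1 hnH
      have h3 : σ⁻¹ * n ∈ N' := hN' ▸ ⟨Ψ.ker.mul_mem (Ψ.ker.inv_mem he) hnker, h2⟩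
      rw [← hqker, map_mul, map_inv] at h3
      exact inv_mul_eq_one.1 h3
  -- the pulled back double cover
  let P : Subgroup (GL (Fin 2) (ZMod ℓ) × (Γ ⧸ N')) :=
    MonoidHom.eqLocus ((QuotientGroup.mk' (ZS ℓ i)).comp (MonoidHom.fst _ _))
      (Ψq.comp (MonoidHom.snd _ _))
  have hP (x : GL (Fin 2) (ZMod ℓ) × (Γ ⧸ N')) :
      x ∈ P ↔ (QuotientGroup.mk x.1 : GL (Fin 2) (ZMod ℓ) ⧸ ZS ℓ i) = Ψq x.2 := Iff.rfl
  let π : P →* GL (Fin 2) (ZMod ℓ) := (MonoidHom.fst _ _).comp P.subtype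
  let c : P := ⟨(1, q n), by rw [hP, hΨc]; rfl⟩
  have hcover : IsDoubleCover π c := by
    refine ⟨fun A => ?_, fun h => hc1 ?_, fun e => ⟨fun he => ?_, ?_⟩⟩
    · obtain ⟨σ, hσ⟩ := hΨ (QuotientGroup.mk A)
      exact ⟨⟨(A, q σ), by rw [hP, hΨq, hσ]⟩, rfl⟩
    · exact congrArg (fun x : P => x.1.2) h
    · obtain ⟨⟨A, e⟩, hAe⟩ := e
      obtain rfl : A = 1 := he
      rcases hker2 e ((hP _).1 hAe).symm with rfl | rfl
      · exact Or.inl rfl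
      · exact Or.inr rfl
    · rintro (rfl | rfl)
      · exact map_one π
      · rfl
  let HP : Subgroup P := ((H'.map q).comap ((MonoidHom.snd _ _).comp P.subtype)) ⊓
    (MulAction.stabilizer (GL (Fin 2) (ZMod ℓ)) v.1).comap π
  have hHP (x : P) : x ∈ HP ↔ x.1.2 ∈ H'.map q ∧ x.1.1.val.mulVec v.1 = v.1 := Iff.rfl
  obtain ⟨S, hHS, hcS, hS⟩ := hcover.exists_splitting_of_stabilizer hℓ v HP
    (fun h => hnH (hqH.1 ((hHP _).1 h).1)) (fun A => by
      constructor
      · rintro ⟨x, hx, rfl⟩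
        exact ((hHP _).1 hx).2
      · intro hA
        obtain ⟨σ, hσ⟩ := hΨ (QuotientGroup.mk A)
        have hσs : qAct ℓ i (Ψ σ) (vClass ℓ i v) = vClass ℓ i v := by
          rw [hσ, qAct_mk]
          exact congrArg _ (Subtype.ext hA)
        by_cases hσH : σ ∈ H'
        · exact ⟨⟨(A, q σ), by rw [hP, hΨq, hσ]⟩, (hHP _).2 ⟨hqH.2 hσH, hA⟩, rfl⟩
        · refine ⟨⟨(A, q (σ * n)), ?_⟩, (hHP _).2 ⟨hqH.2 ?_, hA⟩, rfl⟩
          · rw [hP, hΨq, map_mul Ψ, MonoidHom.mem_ker.1 hnker, mul_one, hσ]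
          · exact hidx _ _ hσs (hker_stab hnker) hσH hnH)
  have hSex (A : GL (Fin 2) (ZMod ℓ)) : ∃ e, ∃ x ∈ S, x.1 = (A, e) := by
    obtain ⟨x, hx, rfl⟩ : A ∈ S.map π := hS ▸ Subgroup.mem_top _
    exact ⟨x.1.2, x, hx, rfl⟩
  have hSuniq {x y : P} (hx : x ∈ S) (hy : y ∈ S) (hxy : x.1.1 = y.1.1) : x = y := by
    rcases hcover.eq_or_of_map_eq (e := x) (f := y) hxy with rfl | rfl
    · rfl
    · exact absurd ((S.mul_mem_cancel_left hy).1 hx) hcS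
  choose f x hxS hxf using hSex
  have hf_eq (y : P) (hy : y ∈ S) : f y.1.1 = y.1.2 := by
    have h1 := hSuniq (hxS y.1.1) hy (by rw [hxf])
    have h2 := hxf y.1.1
    rw [h1] at h2
    rw [h2]
  let Φ : GL (Fin 2) (ZMod ℓ) →* Γ ⧸ N' := MonoidHom.mk' f fun A B => by
    have h1 := hf_eq (x A * x B) (S.mul_mem (hxS A) (hxS B))
    simpa [hxf] using h1
  have hΦ (A : GL (Fin 2) (ZMod ℓ)) : Ψq (Φ A) = QuotientGroup.mk A := by
    have h1 := (hP _).1 (x A).2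
    rw [hxf] at h1
    exact h1.symm
  have hΦH (A : GL (Fin 2) (ZMod ℓ)) (hA : A.val.mulVec v.1 = v.1) : Φ A ∈ H'.map q := by
    obtain ⟨σ, hσ⟩ := hΨ (QuotientGroup.mk A)
    have hσs : qAct ℓ i (Ψ σ) (vClass ℓ i v) = vClass ℓ i v := by
      rw [hσ, qAct_mk]
      exact congrArg _ (Subtype.ext hA)
    have hgen (τ : Γ) (hτ : Ψ τ = QuotientGroup.mk A) (hτH : τ ∈ H') : Φ A ∈ H'.map q := by
      let y : P := ⟨(A, q τ), by rw [hP, hΨq, hτ]⟩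
      have hy : y ∈ S := hHS ((hHP _).2 ⟨hqH.2 hτH, hA⟩)
      have h1 : f A = q τ := hf_eq y hy
      change f A ∈ H'.map q
      rw [h1]
      exact hqH.2 hτH
    by_cases hσH : σ ∈ H'
    · exact hgen σ hσ hσH
    · refine hgen (σ * n) ?_ (hidx _ _ hσs (hker_stab hnker) hσH hnH)
      rw [map_mul, MonoidHom.mem_ker.1 hnker, mul_one, hσ]
  have hcc : q n * q n = 1 := by
    rcases hker2 (q n * q n) (by rw [map_mul, hΨc, one_mul]) with h | h
    · exact h
    · exact absurd (mul_eq_left.1 h) hc1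
  have hsplit (e : Γ ⧸ N') : ∃ A, e = Φ A ∨ e = Φ A * q n := by
    obtain ⟨A, hA⟩ := QuotientGroup.mk_surjective (Ψq e)
    refine ⟨A, ?_⟩
    rcases hker2 ((Φ A)⁻¹ * e) (by rw [map_mul, map_inv, hΦ, hA, inv_mul_cancel]) with h | h
    · exact Or.inl (inv_mul_eq_one.1 h).symm
    · exact Or.inr (by rw [← h, mul_inv_cancel_left])
  obtain ⟨A₀, hA₀⟩ : ∃ A, Φ A = q n := by
    by_contra hcon
    have hcR : q n ∉ Φ.range := fun ⟨A, hA⟩ => hcon ⟨A, hA⟩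
    have hJ : (Φ.range.comap q).index = 2 := by
      rw [Subgroup.index_eq_two_iff]
      refine ⟨n, fun σ => ?_⟩
      simp only [Subgroup.mem_comap, map_mul]
      obtain ⟨A, hA | hA⟩ := hsplit (q σ)
      · refine Or.inr ⟨hA ▸ ⟨A, rfl⟩, fun h => hcR ?_⟩
        rw [hA] at h
        exact (Φ.range.mul_mem_cancel_left ⟨A, rfl⟩).1 h
      · refine Or.inl ⟨?_, fun h => hcR ?_⟩
        · rw [hA, mul_assoc, hcc, mul_one]
          exact ⟨A, rfl⟩
        · rw [hA] at h
          exact (Φ.range.mul_mem_cancel_left ⟨A, rfl⟩).1 h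
    exact hcR (hchar _ hJ (fun σ hσ => by
      rw [Subgroup.mem_comap, hqker.2 hσ]
      exact one_mem _) hnker)
  have hΦsurj : Function.Surjective Φ := by
    intro e
    obtain ⟨A, rfl | rfl⟩ := hsplit e
    · exact ⟨A, rfl⟩
    · exact ⟨A * A₀, by rw [map_mul, hA₀]⟩
  have hΦscalar {s : (ZMod ℓ)ˣ} (hs : s ∈ Sgrp ℓ (i + 1)) : Φ (scalarGL ℓ s) = 1 := by
    obtain ⟨y, rfl⟩ := hs
    have h1 : Ψq (Φ (scalarGL ℓ (y ^ 2 ^ i))) = 1 := by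
      rw [hΦ]
      exact (QuotientGroup.eq_one_iff _).2 (scalarGL_mem_ZS.2 ⟨y, rfl⟩)
    rw [powMonoidHom_apply, pow_succ, pow_mul, pow_two, map_mul, map_mul]
    rcases hker2 _ h1 with h | h
    · rw [h, one_mul]
    · rw [h, hcc]
  have hmem_i {A : GL (Fin 2) (ZMod ℓ)} (hA : Ψq (Φ A) = 1) :
      ∃ s ∈ Sgrp ℓ i, scalarGL ℓ s = A := by
    rw [hΦ] at hA
    exact (QuotientGroup.eq_one_iff _).1 hA
  have hΦker : Φ.ker = ZS ℓ (i + 1) := by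
    apply le_antisymm
    · intro A hA
      obtain ⟨s, hs, rfl⟩ := hmem_i (A := A) (by rw [MonoidHom.mem_ker.1 hA, map_one])
      rw [scalarGL_mem_ZS]
      by_contra hs'
      obtain ⟨t, ht, rfl⟩ := hmem_i (A := A₀) (by rw [hA₀, hΨc])
      have ht' : t ∉ Sgrp ℓ (i + 1) := fun h => hc1 (by rw [← hA₀, hΦscalar h])
      have h1 := hΦscalar (mul_mem_Sgrp_succ hs ht hs' ht')
      rw [map_mul, map_mul, MonoidHom.mem_ker.1 hA, one_mul, hA₀] at h1
      exact hc1 h1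
    · rintro _ ⟨s, hs, rfl⟩
      exact hΦscalar hs
  let Θ : GL (Fin 2) (ZMod ℓ) ⧸ ZS ℓ (i + 1) ≃* Γ ⧸ N' :=
    (QuotientGroup.quotientMulEquivOfEq hΦker.symm).trans
      (QuotientGroup.quotientKerEquivOfSurjective Φ hΦsurj)
  have hΘ (A : GL (Fin 2) (ZMod ℓ)) : Θ (QuotientGroup.mk A) = Φ A := rfl
  let Ψ' : Γ →* GL (Fin 2) (ZMod ℓ) ⧸ ZS ℓ (i + 1) := Θ.symm.toMonoidHom.comp q
  have hΨ' (σ : Γ) : ∃ A, Ψ' σ = QuotientGroup.mk A ∧ Φ A = q σ := by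
    obtain ⟨A, hA⟩ := hΦsurj (q σ)
    refine ⟨A, ?_, hA⟩
    change Θ.symm (q σ) = _
    rw [MulEquiv.symm_apply_eq, hΘ, hA]
  refine ⟨Ψ', Θ.symm.surjective.comp hq, ?_, fun σ => ?_, fun σ => ?_⟩
  · ext σ
    rw [MonoidHom.mem_ker, ← hqker]
    exact map_eq_one_iff Θ.symm Θ.symm.injective
  · obtain ⟨A, hA, hA'⟩ := hΨ' σ
    rw [hA, ← hΨq, ← hA', hΦ]
    rfl
  · obtain ⟨A, hA, hA'⟩ := hΨ' σ
    rw [hA, qAct_mk_eq_self_iff]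
    constructor
    · intro hσ
      have h1 := hstab σ hσ
      rw [← hΨq, ← hA', hΦ, qAct_mk_eq_self_iff] at h1
      obtain ⟨s, hs, hsv⟩ := h1
      refine ⟨s, ?_, hsv⟩
      have h2 := hΦH _ hsv
      rw [map_mul, hA', (H'.map q).mul_mem_cancel_right (hqH.2 hσ)] at h2
      rw [← scalarGL_mem_ZS, ← hΦker, MonoidHom.mem_ker]
      refine (hker2 (Φ (scalarGL ℓ s)) ?_).resolve_right fun h => ?_
      · rw [hΦ]
        exact (QuotientGroup.eq_one_iff _).2 (scalarGL_mem_ZS.2 hs)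
      · rw [h] at h2
        exact hnH (hqH.1 h2)
    · rintro ⟨s, hs, hsv⟩
      have h2 := hΦH _ hsv
      rw [map_mul, hA', hΦscalar hs, one_mul] at h2
      exact hqH.1 h2

end Step

instance isAlgClosure_Om : IsAlgClosure ℚ Om :=
  @AlgebraicClosure.instIsAlgClosure ℚ _

instance isAlgebraic_Om : Algebra.IsAlgebraic ℚ Om := isAlgClosure_Om.isAlgebraic

instance normal_Om : Normal ℚ Om := IsAlgClosure.normal ℚ Om

instance isGalois_Om : IsGalois ℚ Om := IsAlgClosure.isGalois ℚ Om

section Ramification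

open NumberField

lemma intCast_mem_iff {M : Type*} [Field M] {p : ℕ} (P : Ideal (𝓞 M)) [P.LiesOver (Ideal.span {(p : ℤ)})] (a : ℤ) :
    (a : 𝓞 M) ∈ P ↔ (p : ℤ) ∣ a := by
  rw [← Ideal.mem_span_singleton, Ideal.mem_of_liesOver P (Ideal.span {(p : ℤ)})]
  simp

variable {M : Type*} [Field M] [NumberField M]

lemma exists_isPrime_liesOver_span {p : ℕ} (hp : p.Prime) :
    ∃ P : Ideal (𝓞 M), P.IsPrime ∧ P.LiesOver (Ideal.span {(p : ℤ)}) := by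
  have hpZ : Prime (p : ℤ) := Nat.prime_iff_prime_int.1 hp
  have : (Ideal.span {(p : ℤ)}).IsPrime := (Ideal.span_singleton_prime hpZ.ne_zero).2 hpZ
  obtain ⟨⟨P, hP, hP'⟩⟩ := Ideal.nonempty_primesOver (S := 𝓞 M) (Ideal.span {(p : ℤ)})
  exact ⟨P, hP, hP'⟩

lemma natCast_notMem_sq {p : ℕ} (hp : p.Prime) (h : ¬ (p : ℤ) ∣ discr M)
    (P : Ideal (𝓞 M)) [P.IsPrime] [P.LiesOver (Ideal.span {(p : ℤ)})] :
    (p : 𝓞 M) ∉ P ^ 2 := by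
  have hpZ : Prime (p : ℤ) := Nat.prime_iff_prime_int.1 hp
  have hbot : Ideal.span {(p : ℤ)} ≠ ⊥ := by simpa using hp.ne_zero
  rw [not_dvd_discr_iff_isUnramifiedIn M (𝓞 M) hpZ,
    Algebra.isUnramifiedIn_iff_forall_ramificationIdx_eq_one] at h
  have h1 := h P inferInstance
  rw [← Ideal.ramificationIdx'_eq_ramificationIdx (p := Ideal.span {(p : ℤ)}) P hbot] at h1
  intro hmem
  have hle : Ideal.map (algebraMap ℤ (𝓞 M)) (Ideal.span {(p : ℤ)}) ≤ P ^ 2 := by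
    rw [Ideal.map_span, Ideal.span_le]
    simpa using hmem
  exact (Ideal.ramificationIdx'_ne_one_iff (hle.trans (Ideal.pow_le_self two_ne_zero))).2 hle h1

/-- A squarefree integer that becomes a square in `M` is prime to the unramified primes. -/
lemma not_dvd_of_sq_eq {p : ℕ} (hp : p.Prime) (h : ¬ (p : ℤ) ∣ discr M) {d : ℤ}
    (hd : Squarefree d) {s : M} (hs : s ^ 2 = d) :
    ¬ (p : ℤ) ∣ d ∧ (p = 2 → d % 4 = 1) := by
  obtain ⟨P, hP, hPp⟩ := exists_isPrime_liesOver_span (M := M) hp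
  have hP2 := natCast_notMem_sq hp h P
  have hpZ : Prime (p : ℤ) := Nat.prime_iff_prime_int.1 hp
  have hsint : IsIntegral ℤ s := by
    refine IsIntegral.of_pow two_pos ?_
    rw [hs]
    exact isIntegral_algebraMap (R := ℤ) (x := d)
  let t : 𝓞 M := ⟨s, hsint⟩
  have ht : t ^ 2 = (d : 𝓞 M) := by
    apply RingOfIntegers.coe_injective
    rw [map_pow, map_intCast]
    exact hs
  have hpd : ¬ (p : ℤ) ∣ d := by
    rintro ⟨e, rfl⟩
    have hpe : ¬ (p : ℤ) ∣ e := by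
      rintro ⟨f, rfl⟩
      exact hpZ.not_isUnit (hd _ ⟨f, by ring⟩)
    have htP : t ∈ P := hP.mem_of_pow_mem 2 (by
      rw [ht, intCast_mem_iff (p := p)]
      exact dvd_mul_right _ _)
    have h1 : (e : 𝓞 M) * (p : 𝓞 M) ∈ P ^ 2 := by
      have := Ideal.pow_mem_pow htP 2
      rw [ht, mul_comm] at this
      exact_mod_cast this
    have h2 := (Ideal.IsPrime.mul_mem_pow P h1)
    rcases h2 with h2 | h2
    · exact hpe ((intCast_mem_iff P e).1 h2)
    · exact hP2 h2
  refine ⟨hpd, ?_⟩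
  rintro rfl
  have hodd : d % 4 = 1 ∨ d % 4 = 3 := by
    have : ¬ (2 : ℤ) ∣ d := by exact_mod_cast hpd
    omega
  refine hodd.resolve_right fun h3 => ?_
  obtain ⟨e, he⟩ : ∃ e : ℤ, 1 + d = 2 * (2 * e) := ⟨(1 + d) / 4, by omega⟩
  have hsq : (1 + t) ^ 2 = 2 * ((2 * e : ℤ) + t) := by
    have : (1 + d : 𝓞 M) = 2 * (2 * e : ℤ) := by exact_mod_cast congrArg (Int.cast (R := 𝓞 M)) he
    calc (1 + t) ^ 2 = (1 + t ^ 2) + 2 * t := by ring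
      _ = _ := by rw [ht, this]; ring
  have h2P : (2 : 𝓞 M) ∈ P := by
    have := (intCast_mem_iff (p := 2) P 2).2 (by norm_num)
    exact_mod_cast this
  have h1t : 1 + t ∈ P := hP.mem_of_pow_mem 2 (by rw [hsq]; exact P.mul_mem_right _ h2P)
  have h4 : (2 : 𝓞 M) * ((2 * e : ℤ) + t) ∈ P ^ 2 := by
    rw [← hsq]
    exact Ideal.pow_mem_pow h1t 2
  rw [mul_comm] at h4
  rcases Ideal.IsPrime.mul_mem_pow P h4 with h5 | h5
  · have h6 : t ∈ P := by
      have := P.sub_mem h5 ((intCast_mem_iff (p := 2) P (2 * e)).2 (by simp))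
      simpa using this
    have h7 : (1 : 𝓞 M) ∈ P := by simpa using P.sub_mem h1t h6
    exact hP.ne_top ((Ideal.eq_top_iff_one P).2 h7)
  · exact hP2 (by exact_mod_cast h5)

/-- For a Galois number field, a prime is unramified iff its inertia groups are trivial. -/
lemma not_dvd_discr_iff_inertia_eq_bot [IsGalois ℚ M] {p : ℕ} (hp : p.Prime)
    (P : Ideal (𝓞 M)) [P.IsPrime] [P.LiesOver (Ideal.span {(p : ℤ)})] :
    ¬ (p : ℤ) ∣ discr M ↔ P.inertia (M ≃ₐ[ℚ] M) = ⊥ := by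
  have hpZ : Prime (p : ℤ) := Nat.prime_iff_prime_int.1 hp
  have hprime : (Ideal.span {(p : ℤ)}).IsPrime := (Ideal.span_singleton_prime hpZ.ne_zero).2 hpZ
  have hbot : Ideal.span {(p : ℤ)} ≠ ⊥ := by simpa using hp.ne_zero
  have hmax : (Ideal.span {(p : ℤ)}).IsMaximal := hprime.isMaximal hbot
  have : IsGaloisGroup (M ≃ₐ[ℚ] M) ℤ (𝓞 M) :=
    IsGaloisGroup.of_isFractionRing (M ≃ₐ[ℚ] M) ℤ (𝓞 M) ℚ M
  have hcard := Ideal.card_inertia_eq_ramificationIdxIn (G := M ≃ₐ[ℚ] M) (Ideal.span {(p : ℤ)}) P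
  rw [not_dvd_discr_iff_isUnramifiedIn M (𝓞 M) hpZ,
    Algebra.isUnramifiedIn_iff_forall_ramificationIdx_eq_one, ← Subgroup.card_eq_one]
  constructor
  · intro h
    refine hcard.trans ?_
    rw [Ideal.ramificationIdxIn_eq_ramificationIdx _ P (M ≃ₐ[ℚ] M)]
    exact h P inferInstance
  · intro h Q hQ hQp
    rw [← Ideal.ramificationIdxIn_eq_ramificationIdx (Ideal.span {(p : ℤ)}) Q (M ≃ₐ[ℚ] M)]
    exact hcard.symm.trans h

end Ramification

section QuadraticFields

open NumberField

lemma exists_squarefree_sq_eq_ratCast {q : ℚ} (hq : q ≠ 0) :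
    ∃ (c : ℚ) (d : ℤ), c ≠ 0 ∧ Squarefree d ∧ c ^ 2 * q = d := by
  obtain ⟨a, b, hab, ha⟩ := Nat.sq_mul_squarefree (q.num * q.den).natAbs
  have hne : q.num * q.den ≠ 0 := mul_ne_zero (Rat.num_ne_zero.2 hq) (by exact_mod_cast q.den_ne_zero)
  have hb : b ≠ 0 := by
    rintro rfl
    exact hne (Int.natAbs_eq_zero.1 (by rw [← hab]; ring))
  refine ⟨q.den / b, (q.num * q.den).sign * a, by
    have := q.den_ne_zero
    positivity, ?_, ?_⟩
  · rw [← Int.squarefree_natAbs, Int.natAbs_mul, Int.natAbs_sign_of_ne_zero hne, one_mul]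
    simpa using ha
  · have h1 : ((q.num * q.den).sign * a : ℤ) * b ^ 2 = q.num * q.den := by
      conv_rhs => rw [← Int.sign_mul_natAbs (q.num * q.den), ← hab]
      push_cast
      ring
    have h2 : (((q.num * q.den).sign * a : ℤ) : ℚ) * b ^ 2 = q.num * q.den := by exact_mod_cast h1
    have h3 : (q.num : ℚ) = q * q.den := (Rat.mul_den_eq_num q).symm
    have hb' : (b : ℚ) ≠ 0 := by exact_mod_cast hb
    have : (((q.num * q.den).sign * a : ℤ) : ℚ) = q * q.den * q.den / b ^ 2 := by
      rw [eq_div_iff (by positivity), h2, ← h3]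
    rw [this]
    field_simp

lemma exists_sq_eq_squarefree {Q : IntermediateField ℚ Om}
    (hQ : Module.finrank ℚ Q = 2) :
    ∃ (d : ℤ) (s : Om), Squarefree d ∧ d ≠ 1 ∧ s ^ 2 = d ∧ Q = IntermediateField.adjoin ℚ {s} := by
  have hfin : FiniteDimensional ℚ Q := Module.finite_of_finrank_pos (by omega)
  have hnebot : Q ≠ ⊥ := by
    rintro rfl
    rw [IntermediateField.finrank_bot] at hQ
    omega
  obtain ⟨x, hxQ, hx⟩ : ∃ x ∈ Q, x ∉ (⊥ : IntermediateField ℚ Om) := by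
    by_contra! h
    exact hnebot (le_bot_iff.1 h)
  have hadj : ∀ y ∈ Q, y ∉ (⊥ : IntermediateField ℚ Om) → Q = IntermediateField.adjoin ℚ {y} := by
    intro y hy hy'
    have hle : IntermediateField.adjoin ℚ {y} ≤ Q := by simpa using hy
    refine (IntermediateField.eq_of_le_of_finrank_le hle ?_).symm
    have hfin' : FiniteDimensional ℚ (IntermediateField.adjoin ℚ {y}) :=
      FiniteDimensional.of_injective (IntermediateField.inclusion hle).toLinearMap
        (IntermediateField.inclusion hle).injective
    have hpos : 0 < Module.finrank ℚ (IntermediateField.adjoin ℚ {y}) := Module.finrank_pos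
    have hne : Module.finrank ℚ (IntermediateField.adjoin ℚ {y}) ≠ 1 := by
      rw [ne_eq, IntermediateField.finrank_eq_one_iff, IntermediateField.adjoin_simple_eq_bot_iff]
      exact hy'
    omega
  obtain ⟨b, c, hbc⟩ : ∃ b c : ℚ, x ^ 2 + algebraMap ℚ Om b * x + algebraMap ℚ Om c = 0 := by
    have hint : IsIntegral ℚ x := (IsIntegral.of_finite ℚ (⟨x, hxQ⟩ : Q)).map Q.val
    have hdeg : (minpoly ℚ x).natDegree = 2 := by
      rw [← IntermediateField.adjoin.finrank hint, ← hQ]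
      exact congrArg (fun E : IntermediateField ℚ Om => Module.finrank ℚ E) (hadj x hxQ hx).symm
    refine ⟨(minpoly ℚ x).coeff 1, (minpoly ℚ x).coeff 0, ?_⟩
    have h2 : (minpoly ℚ x).coeff 2 = 1 := by
      rw [← hdeg]
      exact minpoly.monic hint
    have := minpoly.aeval ℚ x
    rw [aeval_eq_sum_range, hdeg] at this
    simp only [Finset.sum_range_succ, Finset.sum_range_zero, h2, Algebra.smul_def] at this
    rw [← this]
    simp
    ring
  have hy : (2 * x + algebraMap ℚ Om b) ^ 2 = algebraMap ℚ Om (b ^ 2 - 4 * c) := by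
    simp only [map_sub, map_mul, map_pow, map_ofNat]
    linear_combination 4 * hbc
  have hynot : 2 * x + algebraMap ℚ Om b ∉ (⊥ : IntermediateField ℚ Om) := by
    intro h
    apply hx
    have h1 := sub_mem h (algebraMap_mem (⊥ : IntermediateField ℚ Om) b)
    have h2 := mul_mem (algebraMap_mem (⊥ : IntermediateField ℚ Om) (1 / 2)) h1
    convert h2 using 1
    simp
  have hq : b ^ 2 - 4 * c ≠ 0 := by
    intro h
    rw [h, map_zero] at hy
    rw [pow_eq_zero_iff two_ne_zero] at hy
    exact hynot (hy ▸ zero_mem _)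
  obtain ⟨e, d, he, hd, hed⟩ := exists_squarefree_sq_eq_ratCast hq
  have hsnot : algebraMap ℚ Om e * (2 * x + algebraMap ℚ Om b) ∉ (⊥ : IntermediateField ℚ Om) := by
    intro h
    apply hynot
    have h2 := mul_mem (algebraMap_mem (⊥ : IntermediateField ℚ Om) e⁻¹) h
    rwa [← mul_assoc, ← map_mul, inv_mul_cancel₀ he, map_one, one_mul] at h2
  have hs : (algebraMap ℚ Om e * (2 * x + algebraMap ℚ Om b)) ^ 2 = d := by
    rw [mul_pow, hy, ← map_pow, ← map_mul, hed, map_intCast]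
  refine ⟨d, algebraMap ℚ Om e * (2 * x + algebraMap ℚ Om b), hd, ?_, hs, hadj _ ?_ hsnot⟩
  · rintro rfl
    apply hsnot
    rw [Int.cast_one, sq_eq_one_iff] at hs
    rcases hs with hs | hs <;> rw [hs]
    · exact one_mem _
    · exact neg_mem (one_mem _)
  · refine mul_mem (algebraMap_mem _ _) (add_mem (mul_mem (ofNat_mem _ 2) hxQ) (algebraMap_mem _ _))

/-- For an odd prime `ℓ` there is at most one quadratic field unramified outside `ℓ`. -/
lemma quadratic_eq_of_unramified_outside {ℓ : ℕ}
    (hℓ : ℓ ≠ 2) {Q₁ Q₂ : IntermediateField ℚ Om} [NumberField Q₁] [NumberField Q₂]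
    (h₁ : Module.finrank ℚ Q₁ = 2) (h₂ : Module.finrank ℚ Q₂ = 2)
    (hr₁ : ∀ p : ℕ, p.Prime → (p : ℤ) ∣ discr Q₁ → p = ℓ)
    (hr₂ : ∀ p : ℕ, p.Prime → (p : ℤ) ∣ discr Q₂ → p = ℓ) : Q₁ = Q₂ := by
  have key : ∀ (Q : IntermediateField ℚ Om) [NumberField Q], Module.finrank ℚ Q = 2 →
      (∀ p : ℕ, p.Prime → (p : ℤ) ∣ discr Q → p = ℓ) →
      ∃ (d : ℤ) (s : Om), d.natAbs = ℓ ∧ d % 4 = 1 ∧ s ^ 2 = d ∧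
        Q = IntermediateField.adjoin ℚ {s} := by
    intro Q _ hQ hr
    obtain ⟨d, s, hd, hd1, hs, hQs⟩ := exists_sq_eq_squarefree hQ
    have hsQ : s ∈ Q := hQs ▸ IntermediateField.mem_adjoin_simple_self ℚ s
    have hs' : (⟨s, hsQ⟩ : Q) ^ 2 = (d : Q) := Subtype.ext (by simpa using hs)
    have h2 := (not_dvd_of_sq_eq Nat.prime_two (fun h => hℓ (hr 2 Nat.prime_two h).symm) hd hs').2 rfl
    refine ⟨d, s, ?_, h2, hs, hQs⟩
    have hsf : Squarefree d.natAbs := Int.squarefree_natAbs.2 hd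
    have hall : ∀ p : ℕ, p.Prime → p ∣ d.natAbs → p = ℓ := by
      intro p hp hpd
      by_contra hne
      exact (not_dvd_of_sq_eq hp (fun h => hne (hr p hp h)) hd hs').1 (Int.natCast_dvd.2 hpd)
    have hn1 : d.natAbs ≠ 1 := by omega
    obtain ⟨p, hp, hpd⟩ := Nat.exists_prime_and_dvd hn1
    have hpl := hall p hp hpd
    obtain ⟨e, he⟩ := hpd
    have he1 : e = 1 := by
      by_contra hne
      obtain ⟨q, hq, hqe⟩ := Nat.exists_prime_and_dvd hne
      have hqp : q = p := (hall q hq (he ▸ hqe.mul_left p)).trans hpl.symm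
      subst hqp
      exact hq.not_isUnit (hsf q (he ▸ mul_dvd_mul_left q hqe))
    rw [he, he1, mul_one, hpl]
  obtain ⟨d₁, s₁, hd₁, hm₁, hs₁, hQs₁⟩ := key Q₁ h₁ hr₁
  obtain ⟨d₂, s₂, hd₂, hm₂, hs₂, hQs₂⟩ := key Q₂ h₂ hr₂
  have hd : d₁ = d₂ := by omega
  subst hd
  rcases sq_eq_sq_iff_eq_or_eq_neg.1 (hs₁.trans hs₂.symm) with h | h
  · rw [hQs₁, hQs₂, h]
  · rw [hQs₁, hQs₂, h]
    refine le_antisymm ?_ ?_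
    · simp [IntermediateField.mem_adjoin_simple_self]
    · have := neg_mem (IntermediateField.mem_adjoin_simple_self ℚ (-s₂))
      rw [IntermediateField.adjoin_simple_le_iff]
      simpa using this

end QuadraticFields

section Compositum

open NumberField

/-- Inertia at an unramified prime of a Galois subfield acts trivially on that subfield. -/
lemma apply_algebraMap_eq_of_mem_inertia {E M : Type*} [Field E] [NumberField E] [Field M]
    [NumberField M] [Algebra E M] [IsGalois ℚ E] {p : ℕ} (hp : p.Prime)
    (hE : ¬ (p : ℤ) ∣ discr E) (P : Ideal (𝓞 M)) [P.IsPrime]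
    [P.LiesOver (Ideal.span {(p : ℤ)})] {σ : M ≃ₐ[ℚ] M} (hσ : σ ∈ P.inertia (M ≃ₐ[ℚ] M)) (x : E) :
    σ (algebraMap E M x) = algebraMap E M x := by
  have h1 : (P.under (𝓞 E)).LiesOver (Ideal.span {(p : ℤ)}) := by
    refine ⟨?_⟩
    rw [Ideal.under_under]
    exact Ideal.LiesOver.over
  have h2 := (not_dvd_discr_iff_inertia_eq_bot hp (P.under (𝓞 E))).1 hE
  have h3 : σ.restrictNormal E ∈ (P.under (𝓞 E)).inertia (E ≃ₐ[ℚ] E) := by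
    intro y
    change algebraMap (𝓞 E) (𝓞 M) (σ.restrictNormal E • y - y) ∈ P
    have := hσ (algebraMap (𝓞 E) (𝓞 M) y)
    have h4 : algebraMap (𝓞 E) (𝓞 M) (σ.restrictNormal E • y) =
        σ • algebraMap (𝓞 E) (𝓞 M) y :=
      RingOfIntegers.coe_injective (σ.restrictNormal_commutes E y)
    rw [map_sub, h4]
    exact this
  rw [h2, Subgroup.mem_bot] at h3
  rw [← σ.restrictNormal_commutes E x, h3]
  rfl

lemma not_dvd_discr_sup {C D : IntermediateField ℚ Om} [NumberField C] [NumberField D]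
    [IsGalois ℚ C] [IsGalois ℚ D] [NumberField ↥(C ⊔ D)] {p : ℕ} (hp : p.Prime)
    (hC : ¬ (p : ℤ) ∣ discr C) (hD : ¬ (p : ℤ) ∣ discr D) :
    ¬ (p : ℤ) ∣ discr ↥(C ⊔ D) := by
  have : Normal ℚ ↥(C ⊔ D) :=
    @IntermediateField.normal_sup ℚ Om _ _ _ C D (IsGalois.to_normal (F := ℚ) (E := C))
      (IsGalois.to_normal (F := ℚ) (E := D))
  have : IsGalois ℚ ↥(C ⊔ D) := ⟨⟩
  obtain ⟨P, hP, hPp⟩ := exists_isPrime_liesOver_span (M := ↥(C ⊔ D)) hp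
  rw [not_dvd_discr_iff_inertia_eq_bot hp P, eq_bot_iff]
  intro σ hσ
  rw [Subgroup.mem_bot]
  have hfix : ∀ E : IntermediateField ℚ Om, (h : E ≤ C ⊔ D) → [NumberField E] → [IsGalois ℚ E] →
      ¬ (p : ℤ) ∣ discr E → ∀ x (hx : x ∈ E), ((σ ⟨x, h hx⟩ : ↥(C ⊔ D)) : Om) = x := by
    intro E h _ _ hE x hx
    let _ : Algebra E ↥(C ⊔ D) := (IntermediateField.inclusion h).toAlgebra
    exact congrArg Subtype.val (apply_algebraMap_eq_of_mem_inertia hp hE P hσ (⟨x, hx⟩ : E))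
  have hmem : σ.liftNormal Om ∈ (C ⊔ D).fixingSubgroup := by
    rw [IntermediateField.fixingSubgroup_sup]
    constructor
    · intro x
      exact (σ.liftNormal_commutes Om ⟨x, le_sup_left (a := C) x.2⟩).trans
        (hfix C le_sup_left hC x x.2)
    · intro x
      exact (σ.liftNormal_commutes Om ⟨x, le_sup_right (b := D) x.2⟩).trans
        (hfix D le_sup_right hD x x.2)
  ext x
  exact (σ.liftNormal_commutes Om x).symm.trans (hmem x)

end Compositum

/-- Two quartic characters all of whose quadratic companions coincide have the same kernel. -/
lemma ker_eq_of_forall_index_two {Γ : Type*} [Group Γ] {χ χ' : Γ →* Multiplicative (ZMod 4)}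
    (hχ : Function.Surjective χ) (hχ' : Function.Surjective χ')
    (h : ∀ J J' : Subgroup Γ, J.index = 2 → J'.index = 2 → χ.ker ⊓ χ'.ker ≤ J →
      χ.ker ⊓ χ'.ker ≤ J' → J = J') : χ.ker = χ'.ker := by
  obtain ⟨a, ha⟩ := hχ (Multiplicative.ofAdd 1)
  obtain ⟨a', ha'⟩ := hχ' (Multiplicative.ofAdd 1)
  have hidx : ∀ (f : Γ →* Multiplicative (ZMod 4)) (b : Γ), (∀ g, f g ^ 2 = 1) → f b ≠ 1 →
      f.ker.index = 2 := by
    intro f b hf hb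
    rw [Subgroup.index_eq_two_iff]
    refine ⟨b, fun g => ?_⟩
    have hg := hf g
    have hb2 := hf b
    simp only [MonoidHom.mem_ker, map_mul]
    revert hg hb hb2
    generalize f g = x
    generalize f b = y
    revert x y
    decide
  have h1 := hidx ((powMonoidHom 2).comp χ) a (fun g => by
    simp only [MonoidHom.comp_apply, powMonoidHom_apply]
    generalize χ g = x
    revert x
    decide) (by simp only [MonoidHom.comp_apply, powMonoidHom_apply, ha]; decide)
  have h2 := hidx ((powMonoidHom 2).comp χ') a' (fun g => by
    simp only [MonoidHom.comp_apply, powMonoidHom_apply]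
    generalize χ' g = x
    revert x
    decide) (by simp only [MonoidHom.comp_apply, powMonoidHom_apply, ha']; decide)
  have hle1 : χ.ker ⊓ χ'.ker ≤ ((powMonoidHom 2).comp χ).ker := fun g hg => by
    have : χ g = 1 := hg.1
    simp [MonoidHom.mem_ker, this]
  have hle2 : χ.ker ⊓ χ'.ker ≤ ((powMonoidHom 2).comp χ').ker := fun g hg => by
    have : χ' g = 1 := hg.2
    simp [MonoidHom.mem_ker, this]
  have h12 := h _ _ h1 h2 hle1 hle2
  have hpar : ∀ g, χ g ^ 2 = 1 ↔ χ' g ^ 2 = 1 := fun g => by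
    simpa [MonoidHom.mem_ker] using SetLike.ext_iff.1 h12 g
  by_cases htriv : ∀ g, χ g = χ' g
  · rw [MonoidHom.ext htriv]
  push Not at htriv
  obtain ⟨b, hb⟩ := htriv
  have h3 := hidx (χ * χ'⁻¹) b (fun g => by
    have := hpar g
    simp only [MonoidHom.mul_apply, MonoidHom.inv_apply]
    revert this
    generalize χ g = x
    generalize χ' g = y
    revert x y
    decide) (by simpa [MonoidHom.mul_apply, mul_inv_eq_one] using hb)
  have h13 := h _ _ h1 h3 hle1 (fun g hg => by
    have e1 : χ g = 1 := hg.1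
    have e2 : χ' g = 1 := hg.2
    simp [MonoidHom.mem_ker, e1, e2])
  ext g
  have hg : χ g ^ 2 = 1 ↔ χ g * (χ' g)⁻¹ = 1 := by
    simpa [MonoidHom.mem_ker] using SetLike.ext_iff.1 h13 g
  have := hpar g
  rw [MonoidHom.mem_ker, MonoidHom.mem_ker]
  revert hg this
  generalize χ g = x
  generalize χ' g = y
  revert x y
  decide

/-- A subgroup containing the fixing subgroup of a finite extension is a fixing subgroup. -/
lemma fixingSubgroup_fixedField_of_le {E : IntermediateField ℚ Om} [FiniteDimensional ℚ E]
    {J : Subgroup (Om ≃ₐ[ℚ] Om)} (hJ : E.fixingSubgroup ≤ J) :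
    (IntermediateField.fixedField J).fixingSubgroup = J := by
  have hopen : IsOpen (J : Set (Om ≃ₐ[ℚ] Om)) :=
    Subgroup.isOpen_mono hJ (IntermediateField.fixingSubgroup_isOpen E)
  exact InfiniteGalois.fixingSubgroup_fixedField ⟨J, J.isClosed_of_isOpen hopen⟩

lemma le_of_fixingSubgroup_le {E E' : IntermediateField ℚ Om}
    (h : E.fixingSubgroup ≤ E'.fixingSubgroup) : E' ≤ E := by
  rw [← InfiniteGalois.fixedField_fixingSubgroup E, ← InfiniteGalois.fixedField_fixingSubgroup E']
  exact IntermediateField.fixedField_antitone h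

lemma ker_restrictNormalHom (E : IntermediateField ℚ Om) [h : Normal ℚ E] :
    (AlgEquiv.restrictNormalHom (F := ℚ) (K₁ := Om) E).ker = E.fixingSubgroup :=
  @IntermediateField.restrictNormalHom_ker ℚ Om _ _ _ E h

/-- Infinite Galois correspondence for a surjection that factors through a finite extension. -/
lemma exists_field_of_hom {A : Type*} [Group A] (χ : (Om ≃ₐ[ℚ] Om) →* A)
    (hχ : Function.Surjective χ) (E : IntermediateField ℚ Om) [FiniteDimensional ℚ E]
    (hE : E.fixingSubgroup ≤ χ.ker) :
    ∃ C : IntermediateField ℚ Om, C ≤ E ∧ C.fixingSubgroup = χ.ker ∧ Normal ℚ C ∧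
      Nonempty ((C ≃ₐ[ℚ] C) ≃* A) := by
  have hfix := fixingSubgroup_fixedField_of_le hE
  have hn : Normal ℚ (IntermediateField.fixedField χ.ker) := by
    have h1 := (InfiniteGalois.normal_iff_isGalois (IntermediateField.fixedField χ.ker)).1
      (by rw [hfix]; exact χ.normal_ker)
    exact h1.to_normal
  refine ⟨IntermediateField.fixedField χ.ker, le_of_fixingSubgroup_le (hE.trans hfix.ge), hfix, hn,
    ⟨?_⟩⟩
  have hker : (AlgEquiv.restrictNormalHom (F := ℚ) (K₁ := Om)
      (IntermediateField.fixedField χ.ker)).ker = χ.ker :=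
    (ker_restrictNormalHom _).trans hfix
  exact ((QuotientGroup.quotientKerEquivOfSurjective _
    (AlgEquiv.restrictNormalHom_surjective Om)).symm.trans
      (QuotientGroup.quotientMulEquivOfEq hker)).trans
      (QuotientGroup.quotientKerEquivOfSurjective χ hχ)

open NumberField in
/-- The field `C` is unramified at all primes other than `ℓ`. -/
def UnramifiedOutside (ℓ : ℕ) (C : IntermediateField ℚ Om) : Prop :=
  ∀ _ : NumberField C, ∀ p : ℕ, p.Prime → (p : ℤ) ∣ discr C → p = ℓ

lemma numberField_of_finiteDimensional (C : IntermediateField ℚ Om) [h : FiniteDimensional ℚ C] :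
    NumberField C := ⟨⟩

open IntermediateField in
lemma finiteDimensional_of_le {C E : IntermediateField ℚ Om} [FiniteDimensional ℚ E] (h : C ≤ E) :
    FiniteDimensional ℚ C :=
  FiniteDimensional.of_injective (inclusion h).toLinearMap (inclusion h).injective

lemma UnramifiedOutside.mono {ℓ : ℕ} {C E : IntermediateField ℚ Om} [FiniteDimensional ℚ E]
    (hE : UnramifiedOutside ℓ E) (h : C ≤ E) : UnramifiedOutside ℓ C := by
  intro hC p hp hpC
  have := numberField_of_finiteDimensional E
  let _ : Algebra C E := (IntermediateField.inclusion h).toAlgebra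
  exact hE this p hp (hpC.trans (NumberField.discr_dvd_discr C E))

lemma UnramifiedOutside.sup {ℓ : ℕ} {C D : IntermediateField ℚ Om} [FiniteDimensional ℚ C]
    [FiniteDimensional ℚ D] [Normal ℚ C] [Normal ℚ D] (hC : UnramifiedOutside ℓ C)
    (hD : UnramifiedOutside ℓ D) : UnramifiedOutside ℓ (C ⊔ D) := by
  intro _ p hp h
  by_contra hne
  have := numberField_of_finiteDimensional C
  have := numberField_of_finiteDimensional D
  have : IsGalois ℚ C := ⟨⟩
  have : IsGalois ℚ D := ⟨⟩
  exact not_dvd_discr_sup hp (fun h => hne (hC ‹_› p hp h)) (fun h => hne (hD ‹_› p hp h)) h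

lemma eq_of_fixingSubgroup_index_two {ℓ : ℕ} (hℓ : ℓ ≠ 2) {C D : IntermediateField ℚ Om}
    (hC : UnramifiedOutside ℓ C) (hD : UnramifiedOutside ℓ D)
    (hC2 : C.fixingSubgroup.index = 2) (hD2 : D.fixingSubgroup.index = 2) : C = D := by
  rw [← IntermediateField.finrank_eq_fixingSubgroup_index] at hC2 hD2
  have : FiniteDimensional ℚ C := Module.finite_of_finrank_pos (hC2 ▸ two_pos)
  have : FiniteDimensional ℚ D := Module.finite_of_finrank_pos (hD2 ▸ two_pos)
  have := numberField_of_finiteDimensional C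
  have := numberField_of_finiteDimensional D
  exact quadratic_eq_of_unramified_outside hℓ hC2 hD2 (hC ‹_›) (hD ‹_›)

lemma eq_of_quartic {ℓ : ℕ} (hℓ : ℓ ≠ 2) {C D : IntermediateField ℚ Om}
    [FiniteDimensional ℚ C] [FiniteDimensional ℚ D] [Normal ℚ C] [Normal ℚ D]
    (hC : UnramifiedOutside ℓ C) (hD : UnramifiedOutside ℓ D)
    (eC : (C ≃ₐ[ℚ] C) ≃* Multiplicative (ZMod 4)) (eD : (D ≃ₐ[ℚ] D) ≃* Multiplicative (ZMod 4)) :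
    C = D := by
  have hker : ∀ (E : IntermediateField ℚ Om) [Normal ℚ E] (e : (E ≃ₐ[ℚ] E) ≃* Multiplicative (ZMod 4)),
      (e.toMonoidHom.comp (AlgEquiv.restrictNormalHom (F := ℚ) (K₁ := Om) E)).ker =
        E.fixingSubgroup := by
    intro E _ e
    exact (MonoidHom.ker_mulEquiv_comp _ e).trans (ker_restrictNormalHom E)
  have hfd : FiniteDimensional ℚ ↥(C ⊔ D) := IntermediateField.finiteDimensional_sup C D
  have key := ker_eq_of_forall_index_two
    (χ := eC.toMonoidHom.comp (AlgEquiv.restrictNormalHom (F := ℚ) (K₁ := Om) C))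
    (χ' := eD.toMonoidHom.comp (AlgEquiv.restrictNormalHom (F := ℚ) (K₁ := Om) D))
    (eC.surjective.comp (AlgEquiv.restrictNormalHom_surjective Om))
    (eD.surjective.comp (AlgEquiv.restrictNormalHom_surjective Om)) (by
      intro J J' hJ hJ' hle hle'
      rw [hker, hker, ← IntermediateField.fixingSubgroup_sup] at hle hle'
      have hu := hC.sup hD
      have h1 := fixingSubgroup_fixedField_of_le hle
      have h2 := fixingSubgroup_fixedField_of_le hle'
      have := eq_of_fixingSubgroup_index_two hℓ
        (hu.mono (C := IntermediateField.fixedField J) (le_of_fixingSubgroup_le (hle.trans h1.ge)))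
        (hu.mono (C := IntermediateField.fixedField J') (le_of_fixingSubgroup_le (hle'.trans h2.ge)))
        (by rw [h1, hJ]) (by rw [h2, hJ'])
      rw [← h1, ← h2, this])
  rw [hker, hker] at key
  exact le_antisymm (le_of_fixingSubgroup_le key.ge) (le_of_fixingSubgroup_le key.le)

section Cyclotomic

variable (ℓ : ℕ) [hℓ : Fact ℓ.Prime]

/-- The `ℓ`-th cyclotomic field inside `Om`. -/
noncomputable abbrev cyclo (ℓ : ℕ) : IntermediateField ℚ Om := IntermediateField.adjoin ℚ {x : Om | x ^ ℓ = 1}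

lemma isCyclotomicExtension_cyclo : IsCyclotomicExtension {ℓ} ℚ (cyclo ℓ) := by
  have hset : {x : Om | x ^ ℓ = 1} = {b : Om | ∃ n ∈ ({ℓ} : Set ℕ), n ≠ 0 ∧ b ^ n = 1} := by
    ext x
    simp [hℓ.out.ne_zero]
  have : NeZero (ℓ : Om) := ⟨by exact_mod_cast hℓ.out.ne_zero⟩
  rw [cyclo, hset]
  refine IntermediateField.isCyclotomicExtension_adjoin_of_exists_isPrimitiveRoot _ _ _ ?_
  rintro n rfl -
  have : IsAlgClosed Om := AlgebraicClosure.isAlgClosed ℚ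
  exact HasEnoughRootsOfUnity.exists_primitiveRoot Om n

lemma finiteDimensional_cyclo : FiniteDimensional ℚ (cyclo ℓ) :=
  have := isCyclotomicExtension_cyclo ℓ
  IsCyclotomicExtension.finiteDimensional {ℓ} ℚ (cyclo ℓ)

lemma unramifiedOutside_cyclo : UnramifiedOutside ℓ (cyclo ℓ) := by
  intro _ p hp hd
  have := isCyclotomicExtension_cyclo ℓ
  have h1 := IsCyclotomicExtension.Rat.natAbs_discr ℓ (cyclo ℓ)
  have h2 : p ∣ ℓ ^ Nat.totient ℓ := by
    refine (Int.natCast_dvd.1 hd).trans ?_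
    rw [h1]
    exact Nat.div_dvd_of_dvd (Nat.prod_primeFactors_pow_totient_ediv_dvd hℓ.out.pos)
  exact (Nat.prime_dvd_prime_iff_eq hp hℓ.out).1 (hp.dvd_of_dvd_pow h2)

variable {ℓ}

lemma isCyclic_gal_of_le_cyclo {C : IntermediateField ℚ Om} (hC : C ≤ cyclo ℓ) :
    Normal ℚ C ∧ IsCyclic (C ≃ₐ[ℚ] C) := by
  have := isCyclotomicExtension_cyclo ℓ
  have := finiteDimensional_cyclo ℓ
  have := numberField_of_finiteDimensional (cyclo ℓ)
  have hG : IsGalois ℚ (cyclo ℓ) := IsCyclotomicExtension.isGalois {ℓ} ℚ (cyclo ℓ)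
  have hcyc : IsCyclic (cyclo ℓ ≃ₐ[ℚ] cyclo ℓ) :=
    (IsCyclotomicExtension.Rat.galEquivZMod ℓ (cyclo ℓ)).isCyclic.2 inferInstance
  have : IsAbelianGalois ℚ (cyclo ℓ) := IsAbelianGalois.of_isCyclic ℚ (cyclo ℓ)
  let _ : Algebra C (cyclo ℓ) := (IntermediateField.inclusion hC).toAlgebra
  have : IsAbelianGalois ℚ C := IsAbelianGalois.tower_bot ℚ C (cyclo ℓ)
  have hn : Normal ℚ C := this.to_normal
  exact ⟨hn, isCyclic_of_surjective _
    (AlgEquiv.restrictNormalHom_surjective (F := ℚ) (K₁ := C) (cyclo ℓ))⟩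

end Cyclotomic

lemma X_sub_C_mul_dvd {R : Type*} [CommRing R] [IsDomain R] {f : R[X]} {a b : R} (hab : a ≠ b)
    (ha : f.IsRoot a) (hb : f.IsRoot b) : (X - C a) * (X - C b) ∣ f := by
  obtain ⟨q, rfl⟩ := dvd_iff_isRoot.2 ha
  refine mul_dvd_mul_left _ (dvd_iff_isRoot.2 ?_)
  rw [IsRoot, eval_mul] at hb
  exact (mul_eq_zero.1 hb).resolve_left (by simpa [sub_eq_zero] using hab.symm)

open NumberField in
/-- If the Galois group of `M` acts faithfully on the roots of `f`, and `f` is squarefree and split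
modulo `v`, then every monic polynomial splitting in `M` splits modulo `v`. -/
lemma splits_map_zmod_of_splits {M : Type*} [Field M] [NumberField M] [IsGalois ℚ M] {f g : ℤ[X]}
    (hf : f.Monic) (hg : g.Monic) {v : ℕ} [Fact v.Prime]
    (hsq : Squarefree (f.map (Int.castRingHom (ZMod v))))
    (hspl : (f.map (Int.castRingHom (ZMod v))).Splits)
    (hfaith : ∀ σ : M ≃ₐ[ℚ] M, (∀ a : M, aeval a f = 0 → σ a = a) → σ = 1)
    (hgM : (g.map (algebraMap ℤ M)).Splits) :
    (g.map (Int.castRingHom (ZMod v))).Splits := by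
  have hv : v.Prime := Fact.out
  obtain ⟨P, hP, hPv⟩ := exists_isPrime_liesOver_span (M := M) hv
  have hbot : Ideal.span {(v : ℤ)} ≠ ⊥ := by simpa using hv.ne_zero
  have hPbot : P ≠ ⊥ := Ideal.ne_bot_of_liesOver_of_ne_bot hbot P
  have hfin : Finite (𝓞 M ⧸ P) := Ideal.finiteQuotientOfFreeOfNeBot P hPbot
  have hmax : P.IsMaximal := hP.isMaximal hPbot
  let : Field (𝓞 M ⧸ P) := Ideal.Quotient.field P
  have : IsGaloisGroup (M ≃ₐ[ℚ] M) ℤ (𝓞 M) :=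
    IsGaloisGroup.of_isFractionRing (M ≃ₐ[ℚ] M) ℤ (𝓞 M) ℚ M
  have hchar : CharP (𝓞 M ⧸ P) v := by
    refine (CharP.charP_iff_prime_eq_zero hv).2 ?_
    have := (intCast_mem_iff (p := v) P v).2 dvd_rfl
    have h := (Ideal.Quotient.eq_zero_iff_mem).2 this
    simpa using h
  obtain ⟨σ, hσ⟩ := IsArithFrobAt.exists_of_isInvariant ℤ (M ≃ₐ[ℚ] M) P
  have hcard : Nat.card (ℤ ⧸ P.under ℤ) = v := by
    rw [← Ideal.LiesOver.over (P := P) (p := Ideal.span {(v : ℤ)})]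
    rw [Nat.card_congr (Int.quotientSpanNatEquivZMod v).toEquiv, Nat.card_zmod]
  have hfrob : ∀ x : 𝓞 M, Ideal.Quotient.mk P (σ • x) = Ideal.Quotient.mk P x ^ v := by
    intro x
    have := hσ.mk_apply x
    rw [hcard] at this
    exact this
  let c : ZMod v →+* 𝓞 M ⧸ P := ZMod.castHom dvd_rfl _
  have hcomp : ∀ h : ℤ[X], (h.map (Int.castRingHom (ZMod v))).map c =
      (h.map (algebraMap ℤ (𝓞 M))).map (Ideal.Quotient.mk P) := by
    intro h
    rw [Polynomial.map_map, Polynomial.map_map]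
    congr 1
    exact RingHom.ext_int _ _
  have hcpow : ∀ x : ZMod v, c x ^ v = c x := fun x => by rw [← map_pow, ZMod.pow_card]
  have hf0 : f.map (Int.castRingHom (ZMod v)) ≠ 0 := hsq.ne_zero
  have hsqk : Squarefree ((f.map (Int.castRingHom (ZMod v))).map c) :=
    ((PerfectField.separable_iff_squarefree.2 hsq).map).squarefree
  have hσ1 : σ = 1 := by
    refine hfaith σ fun a ha => ?_
    let t : 𝓞 M := ⟨a, f, hf, by rwa [aeval_def] at ha⟩
    have ht : (f.map (algebraMap ℤ (𝓞 M))).IsRoot t := by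
      rw [IsRoot, eval_map_algebraMap]
      apply RingOfIntegers.coe_injective
      rw [map_zero, ← aeval_algebraMap_apply]
      exact ha
    have hσt : (f.map (algebraMap ℤ (𝓞 M))).IsRoot (σ • t) := by
      rw [IsRoot, eval_map_algebraMap] at ht ⊢
      rw [aeval_smul, ht, smul_zero]
    by_contra hne
    have htne : t ≠ σ • t := fun h => hne (congrArg (algebraMap (𝓞 M) M) h).symm
    have hroot : (((f.map (Int.castRingHom (ZMod v))).map c)).IsRoot (Ideal.Quotient.mk P t) := by
      rw [hcomp]
      exact ht.map
    obtain ⟨x, hx⟩ := hspl.mem_range_of_isRoot hf0 hroot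
    have hdvd := Polynomial.map_dvd (Ideal.Quotient.mk P) (X_sub_C_mul_dvd htne ht hσt)
    rw [← hcomp, Polynomial.map_mul] at hdvd
    simp only [Polynomial.map_sub, map_X, map_C, hfrob, ← hx, hcpow] at hdvd
    exact not_isUnit_X_sub_C _ (hsqk _ hdvd)
  have hsurj : ∀ x : 𝓞 M ⧸ P, x ∈ c.range := by
    intro x
    obtain ⟨x, rfl⟩ := Ideal.Quotient.mk_surjective x
    have hx := hfrob x
    rw [hσ1, one_smul] at hx
    exact (bot_le : ⊥ ≤ c.fieldRange) ((Subfield.mem_bot_iff_pow_eq_self (𝓞 M ⧸ P) v).2 hx.symm)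
  have hgO : (g.map (algebraMap ℤ (𝓞 M))).Splits := by
    refine Splits.of_splits_map_of_injective (i := algebraMap (𝓞 M) M)
      RingOfIntegers.coe_injective ?_ ?_
    · rwa [Polynomial.map_map, ← IsScalarTower.algebraMap_eq]
    · intro a ha
      rw [Polynomial.map_map, ← IsScalarTower.algebraMap_eq] at ha
      have hint : IsIntegral ℤ a := ⟨g, hg, by
        have := isRoot_of_mem_roots ha
        rwa [IsRoot, eval_map] at this⟩
      exact ⟨⟨a, hint⟩, rfl⟩
  refine Splits.of_splits_map c ?_ fun a _ => hsurj a
  rw [hcomp]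
  exact hgO.map _

lemma exists_eq_prod_X_sub_C {k : Type*} [Field k] {f : k[X]} {n : ℕ} (hf : f.Monic)
    (hn : f.natDegree = n) (hs : f.Splits) : ∃ g : Fin n → k, f = ∏ i, (X - C (g i)) := by
  obtain ⟨l, hl⟩ := Quot.exists_rep f.roots
  have hlen : l.length = n := by
    rw [← hn, hs.natDegree_eq_card_roots, ← hl]
    rfl
  subst hlen
  refine ⟨l.get, ?_⟩
  conv_lhs => rw [hs.eq_prod_roots_of_monic hf, ← hl]
  rw [← List.prod_ofFn]
  simp only [List.get_eq_getElem]
  rw [List.ofFn_getElem_eq_map l fun a => X - C a]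
  simp

lemma exists_aeval_eq_add_mul {β b : Om} (hb : b ^ 2 = β) (p : ℚ[X]) :
    ∃ u ∈ IntermediateField.adjoin ℚ {β}, ∃ w ∈ IntermediateField.adjoin ℚ {β},
      aeval b p = u + w * b := by
  induction p using Polynomial.induction_on with
  | C a =>
    exact ⟨algebraMap ℚ Om a, IntermediateField.algebraMap_mem _ a, 0, zero_mem _, by simp⟩
  | add p q hp hq =>
    obtain ⟨u, hu, w, hw, h⟩ := hp
    obtain ⟨u', hu', w', hw', h'⟩ := hq
    exact ⟨u + u', add_mem hu hu', w + w', add_mem hw hw', by rw [map_add, h, h']; ring⟩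
  | monomial n a h =>
    obtain ⟨u, hu, w, hw, h⟩ := h
    refine ⟨w * β, mul_mem hw (IntermediateField.mem_adjoin_simple_self ℚ β), u, hu, ?_⟩
    rw [pow_succ, ← mul_assoc, map_mul, h, aeval_X, ← hb]
    ring

/-- If a normal field `κ` inside `E` embeds in `ℚ[x]/(R(x²))`, with `R` the minimal polynomial of
`β`, but is not contained in `ℚ(β)`, then the square roots of `β` lie in `E`. -/
lemma mem_of_algHom_quotient {β b : Om} (hb : b ^ 2 = β) {κ E : IntermediateField ℚ Om}
    [hnorm : Normal ℚ κ] (hκ : κ ≤ E) (hβ : β ∈ E) (hn : ¬ κ ≤ IntermediateField.adjoin ℚ {β})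
    (f : κ →ₐ[ℚ] ℚ[X] ⧸ Ideal.span {(minpoly ℚ β).comp (X ^ 2 : ℚ[X])}) : b ∈ E := by
  have hle : IntermediateField.adjoin ℚ {β} ≤ E := by
    simpa [IntermediateField.adjoin_simple_le_iff] using hβ
  let ev : (ℚ[X] ⧸ Ideal.span {(minpoly ℚ β).comp (X ^ 2 : ℚ[X])}) →ₐ[ℚ] Om :=
    Ideal.Quotient.liftₐ _ (aeval b) (by
      intro a ha
      obtain ⟨q, rfl⟩ := Ideal.mem_span_singleton'.1 ha
      rw [map_mul, aeval_comp, map_pow, aeval_X, hb, minpoly.aeval, mul_zero])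
  have hrange : (ev.comp f).fieldRange = κ :=
    @AlgHom.fieldRange_of_normal _ _ _ _ _ _ hnorm _
  obtain ⟨k, hk, hkβ⟩ := SetLike.not_le_iff_exists.1 hn
  rw [← hrange] at hk
  obtain ⟨k', rfl⟩ := hk
  obtain ⟨p, hp⟩ := Ideal.Quotient.mk_surjective (f k')
  obtain ⟨u, hu, w, hw, h⟩ := exists_aeval_eq_add_mul hb p
  have hk : ev.comp f k' = u + w * b := by
    rw [← h, AlgHom.comp_apply, ← hp]
    rfl
  have hkE : ev.comp f k' ∈ E := hκ (hrange.le ⟨k', rfl⟩)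
  have hw0 : w ≠ 0 := by
    rintro rfl
    apply hkβ
    change ev.comp f k' ∈ _
    rw [hk]
    simpa using hu
  have : b = (ev.comp f k' - u) / w := by
    rw [hk]
    field_simp
    ring
  rw [this]
  exact div_mem (sub_mem hkE (hle hu)) (hle hw)

instance fixingSubgroup_normal_of_normal (E : IntermediateField ℚ Om) [Normal ℚ E] :
    E.fixingSubgroup.Normal := by
  rw [← ker_restrictNormalHom]
  infer_instance

lemma apply_conj_eq {E : IntermediateField ℚ Om} [Normal ℚ E] {δ s : Om} (hs : s ^ 2 = δ)
    (key : ∀ τ : Om ≃ₐ[ℚ] Om, τ δ ≠ δ → τ s / s ∈ E) {σ : Om ≃ₐ[ℚ] Om}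
    (hσ : σ ∈ E.fixingSubgroup) (hσs : σ s = s) (τ : Om ≃ₐ[ℚ] Om) : σ (τ s) = τ s := by
  by_cases hs0 : s = 0
  · simp [hs0]
  by_cases hτ : τ δ = δ
  · have h : (τ s) ^ 2 = s ^ 2 := by rw [← map_pow, hs, hτ]
    rcases sq_eq_sq_iff_eq_or_eq_neg.1 h with h | h <;> simp [h, hσs]
  · have h := (IntermediateField.mem_fixingSubgroup_iff _ _).1 hσ _ (key τ hτ)
    rw [map_div₀, hσs] at h
    field_simp at h
    exact h

lemma mem_adjoin_simple_fixingSubgroup_iff {a : Om} {σ : Om ≃ₐ[ℚ] Om} :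
    σ ∈ (IntermediateField.adjoin ℚ {a}).fixingSubgroup ↔ σ a = a := by
  constructor
  · intro h
    exact (IntermediateField.mem_fixingSubgroup_iff _ _).1 h _
      (IntermediateField.mem_adjoin_simple_self ℚ a)
  · intro h
    have : IntermediateField.adjoin ℚ {a} ≤
        IntermediateField.fixedField (Subgroup.zpowers σ) := by
      rw [IntermediateField.adjoin_simple_le_iff]
      rintro ⟨τ, hτ⟩
      exact (Subgroup.zpowers_le.2 (show σ ∈ MulAction.stabilizer (Om ≃ₐ[ℚ] Om) a from h)) hτ
    exact (IntermediateField.le_iff_le _ _).1 this (Subgroup.mem_zpowers σ)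

variable {ℓ : ℕ} [Fact ℓ.Prime]

/-- One step of the tower: a surjection of the absolute Galois group onto `GL₂/S_i` with kernel
fixing `E` lifts to one onto `GL₂/S_{i+1}` with kernel fixing `E'`. -/
lemma exists_lift_of_tower_step (hℓ : ℓ ≠ 2) {i : ℕ} {E E' K K' : IntermediateField ℚ Om}
    [Normal ℚ E] [Normal ℚ E'] {δ s z' : Om} (hs : s ^ 2 = δ)
    (hK : K = IntermediateField.adjoin ℚ {δ})
    (hK' : K' = K ⊔ IntermediateField.adjoin ℚ {s})
    (hz' : K' = IntermediateField.adjoin ℚ {z'}) (hKE : K ≤ E) (hEE' : E ≤ E') (hKE' : K' ≤ E')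
    (hconj : ∀ σ : Om ≃ₐ[ℚ] Om, (∀ τ : Om ≃ₐ[ℚ] Om, σ (τ z') = τ z') → σ ∈ E'.fixingSubgroup)
    (key : ∀ τ : Om ≃ₐ[ℚ] Om, τ δ ≠ δ → τ s / s ∈ E) (hne : ¬ E' ≤ E)
    (hchar : ∀ J : Subgroup (Om ≃ₐ[ℚ] Om), J.index = 2 → E'.fixingSubgroup ≤ J →
      E.fixingSubgroup ≤ J)
    (Ψ : (Om ≃ₐ[ℚ] Om) →* GL (Fin 2) (ZMod ℓ) ⧸ ZS ℓ i) (hΨ : Function.Surjective Ψ)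
    (hker : Ψ.ker = E.fixingSubgroup) (v : Vset ℓ)
    (hstab : ∀ σ, σ ∈ K.fixingSubgroup ↔ qAct ℓ i (Ψ σ) (vClass ℓ i v) = vClass ℓ i v) :
    ∃ Ψ' : (Om ≃ₐ[ℚ] Om) →* GL (Fin 2) (ZMod ℓ) ⧸ ZS ℓ (i + 1), Function.Surjective Ψ' ∧
      Ψ'.ker = E'.fixingSubgroup ∧ (∀ σ, projQ ℓ (i + 1) (Ψ' σ) = projQ ℓ i (Ψ σ)) ∧
      ∀ σ, σ ∈ K'.fixingSubgroup ↔
        qAct ℓ (i + 1) (Ψ' σ) (vClass ℓ (i + 1) v) = vClass ℓ (i + 1) v := by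
  have hz'fix : ∀ σ, σ ∈ K'.fixingSubgroup ↔ σ z' = z' := fun σ => by
    rw [hz', mem_adjoin_simple_fixingSubgroup_iff]
  have hmemK' : ∀ σ, σ ∈ K'.fixingSubgroup ↔ σ ∈ K.fixingSubgroup ∧ σ s = s := fun σ => by
    rw [hK', IntermediateField.fixingSubgroup_sup, Subgroup.mem_inf,
      mem_adjoin_simple_fixingSubgroup_iff]
  have hconj_mem : ∀ σ : Om ≃ₐ[ℚ] Om, (∀ τ : Om ≃ₐ[ℚ] Om, τ⁻¹ * σ * τ ∈ K'.fixingSubgroup) →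
      σ ∈ E'.fixingSubgroup := by
    intro σ h
    refine hconj σ fun τ => ?_
    have := (hz'fix _).1 (h τ)
    rw [AlgEquiv.mul_apply, AlgEquiv.mul_apply] at this
    have h2 := congrArg τ this
    rwa [← AlgEquiv.mul_apply τ, mul_inv_cancel, AlgEquiv.one_apply] at h2
  have hEconj : ∀ σ τ : Om ≃ₐ[ℚ] Om, σ ∈ E.fixingSubgroup → τ⁻¹ * σ * τ ∈ E.fixingSubgroup := by
    intro σ τ h
    simpa using (fixingSubgroup_normal_of_normal E).conj_mem σ h τ⁻¹
  refine exists_lift_to_succ hℓ i Ψ hΨ v E'.fixingSubgroup K'.fixingSubgroup ?_ ?_ ?_ ?_ ?_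
  · rw [hker]
    apply le_antisymm
    · exact le_inf (IntermediateField.fixingSubgroup_le hEE')
        (IntermediateField.fixingSubgroup_le hKE')
    · rintro σ ⟨hσE, hσK⟩
      refine hconj_mem σ fun τ => (hmemK' _).2
        ⟨IntermediateField.fixingSubgroup_le hKE (hEconj σ τ hσE), ?_⟩
      rw [AlgEquiv.mul_apply, AlgEquiv.mul_apply,
        apply_conj_eq hs key hσE ((hmemK' σ).1 hσK).2 τ, ← AlgEquiv.mul_apply,
        inv_mul_cancel, AlgEquiv.one_apply]
  · exact fun σ hσ => (hstab σ).1 ((hmemK' σ).1 hσ).1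
  · intro σ τ hσ hτ hσ' hτ'
    have hneg : ∀ σ, σ ∈ K.fixingSubgroup → σ ∉ K'.fixingSubgroup → σ s = - s := by
      intro σ hσ hσ'
      have h : (σ s) ^ 2 = s ^ 2 := by
        rw [← map_pow, hs]
        rwa [hK, mem_adjoin_simple_fixingSubgroup_iff] at hσ
      exact (sq_eq_sq_iff_eq_or_eq_neg.1 h).resolve_left fun h => hσ' ((hmemK' σ).2 ⟨hσ, h⟩)
    refine (hmemK' _).2 ⟨mul_mem ((hstab σ).2 hσ) ((hstab τ).2 hτ), ?_⟩
    rw [AlgEquiv.mul_apply, hneg τ ((hstab τ).2 hτ) hτ', map_neg, hneg σ ((hstab σ).2 hσ) hσ',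
      neg_neg]
  · rw [hker]
    intro h
    exact hne (le_of_fixingSubgroup_le fun σ hσ => hconj_mem σ fun τ => h (hEconj σ τ hσ))
  · rwa [hker]

/-- Roots of an irreducible polynomial are conjugate. -/
lemma exists_apply_eq_of_mem_rootSet {f : ℤ[X]} (hf : f.Monic) (hirr : Irreducible f) {x y : Om}
    (hx : x ∈ f.rootSet Om) (hy : y ∈ f.rootSet Om) : ∃ σ : Om ≃ₐ[ℚ] Om, σ x = y := by
  have hirrQ : Irreducible (f.map (algebraMap ℤ ℚ)) :=
    (hf.irreducible_iff_irreducible_map_fraction_map (K := ℚ)).1 hirr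
  have hmin : ∀ x ∈ f.rootSet Om, f.map (algebraMap ℤ ℚ) = minpoly ℚ x := by
    intro x hx
    refine minpoly.eq_of_irreducible_of_monic hirrQ ?_ (hf.map _)
    rw [aeval_map_algebraMap]
    exact (mem_rootSet.1 hx).2
  have h : IsConjRoot ℚ y x := by
    rw [isConjRoot_def, ← hmin x hx, ← hmin y hy]
  obtain ⟨σ, hσ⟩ := isConjRoot_iff_exists_algEquiv.1 h
  exact ⟨σ, hσ⟩

lemma apply_mem_rootSet {f : ℤ[X]} {x : Om} (hx : x ∈ f.rootSet Om) (σ : Om ≃ₐ[ℚ] Om) :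
    σ x ∈ f.rootSet Om := by
  rw [mem_rootSet] at hx ⊢
  refine ⟨hx.1, ?_⟩
  have := congrArg σ hx.2
  rw [map_zero] at this
  rw [← this]
  exact aeval_algHom_apply (σ.toAlgHom.restrictScalars ℤ) x f

section SplittingField

lemma rootSet_map_algebraMap_int (f : ℤ[X]) :
    (f.map (algebraMap ℤ ℚ)).rootSet Om = f.rootSet Om := by
  rw [rootSet, rootSet, aroots, aroots, Polynomial.map_map]
  congr 3

lemma normal_adjoin_rootSet (f : ℤ[X]) :
    Normal ℚ (IntermediateField.adjoin ℚ (f.rootSet Om)) ∧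
      FiniteDimensional ℚ (IntermediateField.adjoin ℚ (f.rootSet Om)) := by
  rw [← rootSet_map_algebraMap_int]
  have : IsAlgClosed Om := AlgebraicClosure.isAlgClosed ℚ
  have h := IntermediateField.adjoin_rootSet_isSplittingField
    (IsAlgClosed.splits ((f.map (algebraMap ℤ ℚ)).map (algebraMap ℚ Om)))
  exact ⟨Normal.of_isSplittingField (hFEp := h), @IsSplittingField.finiteDimensional _ _ _ _ _ _ h⟩

lemma mem_fixingSubgroup_of_forall_rootSet {f : ℤ[X]} {σ : Om ≃ₐ[ℚ] Om}
    (h : ∀ x ∈ f.rootSet Om, σ x = x) :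
    σ ∈ (IntermediateField.adjoin ℚ (f.rootSet Om)).fixingSubgroup := by
  have : IntermediateField.adjoin ℚ (f.rootSet Om) ≤
      IntermediateField.fixedField (Subgroup.zpowers σ) := by
    rw [IntermediateField.adjoin_le_iff]
    rintro a ha ⟨τ, hτ⟩
    exact (Subgroup.zpowers_le.2 (show σ ∈ MulAction.stabilizer (Om ≃ₐ[ℚ] Om) a from h a ha)) hτ
  exact (IntermediateField.le_iff_le _ _).1 this (Subgroup.mem_zpowers σ)

/-- If `f` splits modulo `v`, squarefree, while `g` does not, then the splitting field of `g` is not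
contained in that of `f`. -/
lemma not_adjoin_rootSet_le {f g : ℤ[X]} (hf : f.Monic) (hg : g.Monic) {v : ℕ} (hv : v.Prime)
    (hsq : Squarefree (f.map (Int.castRingHom (ZMod v))))
    (hspl : ∃ c : Fin f.natDegree → ZMod v,
      f.map (Int.castRingHom (ZMod v)) = ∏ k, (X - C (c k)))
    (hnot : ¬ ∃ c : Fin g.natDegree → ZMod v,
      g.map (Int.castRingHom (ZMod v)) = ∏ k, (X - C (c k))) :
    ¬ IntermediateField.adjoin ℚ (g.rootSet Om) ≤ IntermediateField.adjoin ℚ (f.rootSet Om) := by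
  intro hle
  have : Fact v.Prime := ⟨hv⟩
  obtain ⟨hnormal, hfin⟩ := normal_adjoin_rootSet f
  generalize hE : IntermediateField.adjoin ℚ (f.rootSet Om) = E at hle hnormal hfin
  have := numberField_of_finiteDimensional E
  have : IsGalois ℚ E := ⟨⟩
  have : IsAlgClosed Om := AlgebraicClosure.isAlgClosed ℚ
  refine hnot (exists_eq_prod_X_sub_C (hg.map _) (hg.natDegree_map _) ?_)
  refine splits_map_zmod_of_splits (M := E) hf hg hsq ?_ ?_ ?_
  · obtain ⟨c, hc⟩ := hspl
    rw [hc]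
    exact Splits.prod fun i _ => Splits.X_sub_C _
  · intro σ hσ
    have h : E.val.comp σ.toAlgHom = E.val := by
      refine IntermediateField.algHom_ext_of_eq_adjoin _ hE.symm ?_
      intro x hx
      have := hσ ⟨x, hE ▸ IntermediateField.subset_adjoin ℚ _ hx⟩ (by
        apply E.val.toRingHom.injective
        rw [map_zero, aeval_def, hom_eval₂, ← (mem_rootSet.1 hx).2, aeval_def]
        exact congrArg (fun c : ℤ →+* Om => f.eval₂ c x) (RingHom.ext_int _ _))
      exact congrArg Subtype.val this
    ext x
    exact DFunLike.congr_fun h x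
  · refine Splits.of_splits_map (algebraMap E Om) (IsAlgClosed.splits _) fun a ha => ?_
    have hroot := isRoot_of_mem_roots ha
    rw [IsRoot, eval_map, eval₂_map] at hroot
    have ha' : a ∈ g.rootSet Om := by
      refine mem_rootSet.2 ⟨hg.ne_zero, hroot ▸ ?_⟩
      exact congrArg (fun c : ℤ →+* Om => g.eval₂ c a) (RingHom.ext_int _ _)
    exact ⟨⟨a, hle (IntermediateField.subset_adjoin ℚ _ ha')⟩, rfl⟩

end SplittingField

section Cyclic

variable {ℓ : ℕ} [Fact ℓ.Prime]

lemma exists_surjective_units_zmod {n : ℕ} (hn : n ∣ ℓ - 1) :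
    ∃ f : (ZMod ℓ)ˣ →* Multiplicative (ZMod n), Function.Surjective f := by
  have hcard : n ∣ Nat.card (ZMod ℓ)ˣ := by
    rwa [Nat.card_eq_fintype_card, ZMod.card_units]
  have hcyc : IsCyclic (ZMod ℓ)ˣ := inferInstance
  refine ⟨(AddMonoidHom.toMultiplicative (ZMod.castHom hcard (ZMod n)).toAddMonoidHom).comp
    (zmodCyclicMulEquiv hcyc).symm.toMonoidHom, ?_⟩
  rw [MonoidHom.coe_comp]
  refine Function.Surjective.comp ?_ (zmodCyclicMulEquiv hcyc).symm.surjective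
  exact ZMod.castHom_surjective hcard

/-- The determinant modulo `2^(i+1)`-th powers, as a cyclic quotient of `GL₂/S_i`. -/
lemma exists_surjective_quotient {i : ℕ} (hi : 2 ^ (i + 1) ∣ ℓ - 1) :
    ∃ χ : (GL (Fin 2) (ZMod ℓ) ⧸ ZS ℓ i) →* Multiplicative (ZMod (2 ^ (i + 1))),
      Function.Surjective χ := by
  obtain ⟨f, hf⟩ := exists_surjective_units_zmod hi
  have hker : ∀ g ∈ ZS ℓ i, f.comp GeneralLinearGroup.det g = 1 := by
    rintro _ ⟨_, ⟨y, rfl⟩, rfl⟩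
    have : GeneralLinearGroup.det (scalarGL ℓ (powMonoidHom (2 ^ i) y)) = y ^ 2 ^ (i + 1) := by
      ext
      simp [scalarGL, pow_succ, pow_mul, mul_pow]
    rw [MonoidHom.comp_apply, this, map_pow]
    have h0 : (2 ^ (i + 1)) • (f y).toAdd = 0 := by
      rw [nsmul_eq_mul, ZMod.natCast_self, zero_mul]
    exact h0
  refine ⟨QuotientGroup.lift _ (f.comp GeneralLinearGroup.det) hker, ?_⟩
  refine QuotientGroup.lift_surjective_of_surjective _ _ ?_ _
  rw [MonoidHom.coe_comp]
  exact hf.comp GeneralLinearGroup.det_surjective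

end Cyclic

section Cyclotomic

variable {ℓ : ℕ} [hℓ' : Fact ℓ.Prime]

lemma unramifiedOutside_of_le_cyclo {C : IntermediateField ℚ Om} (hC : C ≤ cyclo ℓ) :
    UnramifiedOutside ℓ C :=
  have := finiteDimensional_cyclo ℓ
  (unramifiedOutside_cyclo ℓ).mono hC

lemma eq_fixingSubgroup_of_index_two (hℓ : ℓ ≠ 2) {κ E : IntermediateField ℚ Om}
    [FiniteDimensional ℚ E] (hκ : κ ≤ cyclo ℓ) (hκ2 : Module.finrank ℚ κ = 2)
    (hE : ∀ C ≤ E, Normal ℚ C → IsCyclic (C ≃ₐ[ℚ] C) → Nat.card (C ≃ₐ[ℚ] C) = 2 →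
      UnramifiedOutside ℓ C)
    {J : Subgroup (Om ≃ₐ[ℚ] Om)} (hJ : J.index = 2) (hle : E.fixingSubgroup ≤ J) :
    J = κ.fixingSubgroup := by
  have := Subgroup.normal_of_index_eq_two hJ
  obtain ⟨C, hCE, hCJ, hCn, ⟨e⟩⟩ := exists_field_of_hom (QuotientGroup.mk' J)
    (QuotientGroup.mk'_surjective J) E (by rwa [QuotientGroup.ker_mk'])
  rw [QuotientGroup.ker_mk'] at hCJ
  have hcard : Nat.card (C ≃ₐ[ℚ] C) = 2 := (Nat.card_congr e.toEquiv).trans hJ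
  have : Fact (Nat.Prime 2) := ⟨Nat.prime_two⟩
  have hC := hE C hCE hCn (isCyclic_of_prime_card hcard) hcard
  rw [← eq_of_fixingSubgroup_index_two hℓ hC (unramifiedOutside_of_le_cyclo hκ) (hCJ ▸ hJ) ?_, hCJ]
  rw [← IntermediateField.finrank_eq_fixingSubgroup_index]
  exact hκ2

lemma quadratic_le (hℓ : ℓ ≠ 2) (h2 : 2 ∣ ℓ - 1) {κ E : IntermediateField ℚ Om}
    [FiniteDimensional ℚ E] (hκ : κ ≤ cyclo ℓ) (hκ2 : Module.finrank ℚ κ = 2)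
    (hE : ∀ C ≤ E, Normal ℚ C → IsCyclic (C ≃ₐ[ℚ] C) → Nat.card (C ≃ₐ[ℚ] C) = 2 →
      UnramifiedOutside ℓ C)
    (Ψ : (Om ≃ₐ[ℚ] Om) →* GL (Fin 2) (ZMod ℓ) ⧸ ZS ℓ 0) (hΨ : Function.Surjective Ψ)
    (hker : Ψ.ker = E.fixingSubgroup) : κ ≤ E := by
  obtain ⟨χ, hχ⟩ := exists_surjective_quotient (ℓ := ℓ) (i := 0) (by simpa using h2)
  have hle : E.fixingSubgroup ≤ (χ.comp Ψ).ker := by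
    rw [← hker]
    exact fun σ hσ => by rw [MonoidHom.mem_ker] at hσ ⊢; simp [hσ]
  have hidx : (χ.comp Ψ).ker.index = 2 := by
    rw [Subgroup.index_ker, MonoidHom.range_eq_top.2 (by
      rw [MonoidHom.coe_comp]; exact hχ.comp hΨ), Subgroup.card_top]
    simp
  exact le_of_fixingSubgroup_le
    (eq_fixingSubgroup_of_index_two hℓ hκ hκ2 hE hidx hle ▸ hle)

lemma quartic_le (hℓ : ℓ ≠ 2) (h4 : 4 ∣ ℓ - 1) {κ E : IntermediateField ℚ Om}
    [FiniteDimensional ℚ E] (hκ : κ ≤ cyclo ℓ) (hκ4 : Module.finrank ℚ κ = 4)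
    (hE : ∀ C ≤ E, Normal ℚ C → IsCyclic (C ≃ₐ[ℚ] C) → Nat.card (C ≃ₐ[ℚ] C) = 4 →
      UnramifiedOutside ℓ C)
    (Ψ : (Om ≃ₐ[ℚ] Om) →* GL (Fin 2) (ZMod ℓ) ⧸ ZS ℓ 1) (hΨ : Function.Surjective Ψ)
    (hker : Ψ.ker = E.fixingSubgroup) : κ ≤ E := by
  obtain ⟨χ, hχ⟩ := exists_surjective_quotient (ℓ := ℓ) (i := 1) (by simpa using h4)
  obtain ⟨C, hCE, -, hCn, ⟨e⟩⟩ := exists_field_of_hom (χ.comp Ψ)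
    (by rw [MonoidHom.coe_comp]; exact hχ.comp hΨ) E
    (by rw [← hker]; exact fun σ hσ => by rw [MonoidHom.mem_ker] at hσ ⊢; simp [hσ])
  have hcard : Nat.card (C ≃ₐ[ℚ] C) = 4 := by
    rw [Nat.card_congr e.toEquiv]
    simp
  have hcyc : IsCyclic (C ≃ₐ[ℚ] C) := e.isCyclic.2 inferInstance
  have hC := hE C hCE hCn hcyc hcard
  obtain ⟨hκn, hκc⟩ := isCyclic_gal_of_le_cyclo hκ
  have := finiteDimensional_of_le hCE
  have : FiniteDimensional ℚ κ := Module.finite_of_finrank_pos (hκ4 ▸ four_pos)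
  have hκG : IsGalois ℚ κ := ⟨⟩
  have hκcard : Nat.card (κ ≃ₐ[ℚ] κ) = 4 := (IsGalois.card_aut_eq_finrank ℚ κ).trans hκ4
  have eκ : (κ ≃ₐ[ℚ] κ) ≃* Multiplicative (ZMod 4) := hκcard ▸ (zmodCyclicMulEquiv hκc).symm
  rw [← eq_of_quartic hℓ hC (unramifiedOutside_of_le_cyclo hκ) e eκ]
  exact hCE

end Cyclotomic

lemma exists_mulEquiv_of_ker_eq {G A B : Type*} [Group G] [Group A] [Group B] {ρ : G →* A}
    {ψ : G →* B} (hρ : Function.Surjective ρ) (hψ : Function.Surjective ψ) (h : ρ.ker = ψ.ker) :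
    ∃ φ : A ≃* B, ∀ g, φ (ρ g) = ψ g := by
  refine ⟨((QuotientGroup.quotientKerEquivOfSurjective ρ hρ).symm.trans
    (QuotientGroup.quotientMulEquivOfEq h)).trans
    (QuotientGroup.quotientKerEquivOfSurjective ψ hψ), fun g => ?_⟩
  have : (QuotientGroup.quotientKerEquivOfSurjective ρ hρ).symm (ρ g) = (g : G ⧸ ρ.ker) := by
    rw [MulEquiv.symm_apply_eq]
    rfl
  rw [MulEquiv.trans_apply, MulEquiv.trans_apply, this]
  rfl

section Conclusion

variable {ℓ : ℕ} [Fact ℓ.Prime]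

/-- A surjection of the absolute Galois group onto `GL₂/S_i` under which the stabilizer of a root of
`f` is the stabilizer of a vector identifies the roots of `f` with `V_i`. -/
lemma exists_equiv_rootSet {i : ℕ} {f : ℤ[X]} (hf : f.Monic) (hirr : Irreducible f) {z : Om}
    (hz : z ∈ f.rootSet Om) (Ψ : (Om ≃ₐ[ℚ] Om) →* GL (Fin 2) (ZMod ℓ) ⧸ ZS ℓ i)
    (hΨ : Function.Surjective Ψ) (v : Vset ℓ)
    (hstab : ∀ σ, σ z = z ↔ qAct ℓ i (Ψ σ) (vClass ℓ i v) = vClass ℓ i v) :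
    ∃ b : f.rootSet Om ≃ Vq ℓ i, ∀ (σ : Om ≃ₐ[ℚ] Om) (x y : f.rootSet Om),
      σ (x : Om) = y → b y = qAct ℓ i (Ψ σ) (b x) := by
  have hiff : ∀ σ τ : Om ≃ₐ[ℚ] Om, σ z = τ z ↔
      qAct ℓ i (Ψ σ) (vClass ℓ i v) = qAct ℓ i (Ψ τ) (vClass ℓ i v) := by
    intro σ τ
    have h := hstab (τ⁻¹ * σ)
    have h1 : σ z = τ z ↔ (τ⁻¹ * σ) z = z := by
      rw [AlgEquiv.mul_apply]
      constructor
      · intro h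
        rw [h, ← AlgEquiv.mul_apply, inv_mul_cancel, AlgEquiv.one_apply]
      · intro h
        have := congrArg τ h
        rwa [← AlgEquiv.mul_apply, mul_inv_cancel, AlgEquiv.one_apply] at this
    rw [h1, h, map_mul, map_inv, qAct_mul]
    constructor
    · intro h
      have := congrArg (qAct ℓ i (Ψ τ)) h
      rwa [← qAct_mul, mul_inv_cancel, qAct_one] at this
    · intro h
      rw [h, ← qAct_mul, inv_mul_cancel, qAct_one]
  choose t ht using fun x : f.rootSet Om => exists_apply_eq_of_mem_rootSet hf hirr hz x.2
  let b : f.rootSet Om → Vq ℓ i := fun x => qAct ℓ i (Ψ (t x)) (vClass ℓ i v)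
  have hb : ∀ (τ : Om ≃ₐ[ℚ] Om) (x : f.rootSet Om), τ z = x →
      b x = qAct ℓ i (Ψ τ) (vClass ℓ i v) :=
    fun τ x h => (hiff _ _).1 ((ht x).trans h.symm)
  refine ⟨Equiv.ofBijective b ⟨fun x y hxy => ?_, fun w => ?_⟩, fun σ x y h => ?_⟩
  · have := (hiff _ _).2 hxy
    rw [ht, ht] at this
    exact Subtype.ext this
  · obtain ⟨g, hg⟩ := exists_qAct_eq i (vClass ℓ i v) w
    obtain ⟨σ, rfl⟩ := hΨ g
    exact ⟨⟨σ z, apply_mem_rootSet hz σ⟩, (hb σ _ rfl).trans hg⟩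
  · change b y = qAct ℓ i (Ψ σ) (b x)
    rw [hb (σ * t x) y (by rw [AlgEquiv.mul_apply, ht, h]), map_mul, qAct_mul]

end Conclusion

lemma projQ_zero_apply {ℓ : ℕ} [Fact ℓ.Prime] (g : GL (Fin 2) (ZMod ℓ) ⧸ ZS ℓ 0) :
    projQ ℓ 0 g = g := by
  induction g using QuotientGroup.induction_on with
  | H A => rfl

open IntermediateField in
/-- Theorem `thm_preuve` of the paper. -/
theorem galois_groups_of_tower_are_GL2_quotients
    -- `ℓ ≥ 5` prime, `ℓ - 1 = 2^r·m` with `m` odd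
    (ℓ r m : ℕ) [Fact ℓ.Prime] (hℓ5 : 5 ≤ ℓ) (hm : Odd m) (hrm : ℓ - 1 = 2 ^ r * m)
    -- the monic irreducible polynomials `F_i ∈ ℤ[x]` of degree `2^i(ℓ+1)`
    (F : ℕ → Polynomial ℤ)
    (hFmonic : ∀ i ≤ r, (F i).Monic)
    (hFirr : ∀ i ≤ r, Irreducible (F i))
    (hFdeg : ∀ i ≤ r, (F i).natDegree = 2 ^ i * (ℓ + 1))
    -- chosen roots `z_i`, root fields `K_i` and splitting fields `L_i` inside `Ω`
    (z : ℕ → Om) (hz : ∀ i ≤ r, z i ∈ (F i).rootSet Om)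
    (K : ℕ → IntermediateField ℚ Om) (hK : ∀ i ≤ r, K i = ℚ⟮z i⟯)
    (L : ℕ → IntermediateField ℚ Om)
    (hL : ∀ i ≤ r, L i = IntermediateField.adjoin ℚ ((F i).rootSet Om))
    (hZL : ∀ i ≤ r, ∀ x ∈ (F i).rootSet Om, x ∈ L i)
    (hLmono : ∀ i < r, L i ≤ L (i + 1))
    (hL0le : ∀ i ≤ r, L 0 ≤ L i)
    -- the subfields `κ_i` of the cyclotomic field `ℚ(μ_ℓ)` of degree `2^i`
    (κ : ℕ → IntermediateField ℚ Om)
    (hκ0 : κ 0 = ⊥)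
    (hκmono : ∀ i < r, κ i < κ (i + 1))
    (hκcyclo : ∀ i ≤ r, κ i ≤ IntermediateField.adjoin ℚ {x : Om | x ^ ℓ = 1})
    (hκdeg : ∀ i ≤ r, Module.finrank ℚ ↥(κ i) = 2 ^ i)
    -- the bijections `θ_i : Z_i → V_i` ...
    (θ : ∀ i, i ≤ r → (↥((F i).rootSet Om) ≃ Vq ℓ i))
    -- ... commuting with the projections `V_{i+1} → V_i` and such that each root of
    -- `F_i` is the sum of the roots of `F_{i+1}` lying above it
    (hθcompat : ∀ i (hir : i < r), ∀ y : ↥((F i).rootSet Om),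
      (y : Om) = ∑ᶠ (x : ↥((F (i + 1)).rootSet Om))
        (_ : VqProj ℓ i (θ (i + 1) hir x) = θ i (le_of_lt hir) y), (x : Om))
    -- the integral primitive elements `δ_i` of `K_i` with `K_{i+1} = K_i(√δ_i)`
    (δ : ℕ → Om) (sqrtδ : ℕ → Om)
    (hδprim : ∀ i < r, ℚ⟮δ i⟯ = K i)
    (hδint : ∀ i < r, IsIntegral ℤ (δ i))
    (hsqrtδ : ∀ i < r, sqrtδ i ^ 2 = δ i)
    (hKsucc : ∀ i < r, K (i + 1) = K i ⊔ ℚ⟮sqrtδ i⟯)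
    -- the identification of `Gal(L_0/ℚ)` with `PGL₂(F_ℓ) = GL₂(F_ℓ)/S_0` ...
    (φ₀ : (↥(L 0) ≃ₐ[ℚ] ↥(L 0)) ≃* (GL (Fin 2) (ZMod ℓ) ⧸ ZS ℓ 0))
    -- ... under which the Galois action on `Z_0` corresponds via `θ_0` to the natural
    -- action of `PGL₂(F_ℓ)` on `V_0 = P¹(F_ℓ)` ...
    (hφ₀equiv : ∀ σ : ↥(L 0) ≃ₐ[ℚ] ↥(L 0), ∀ x y : ↥((F 0).rootSet Om),
      σ ⟨(x : Om), hZL 0 (Nat.zero_le r) (x : Om) x.2⟩ =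
        ⟨(y : Om), hZL 0 (Nat.zero_le r) (y : Om) y.2⟩ →
      θ 0 (Nat.zero_le r) y = qAct ℓ 0 (φ₀ σ) (θ 0 (Nat.zero_le r) x))
    -- ... and under which the image of a complex conjugation is the class of `diag(1,-1)`
    (hφ₀conj : ∃ (ι : ↥(L 0) →+* ℂ) (σ : ↥(L 0) ≃ₐ[ℚ] ↥(L 0)),
      (∀ t : ↥(L 0), ι (σ t) = starRingEnd ℂ (ι t)) ∧
      φ₀ σ = QuotientGroup.mk (diagOneNegOne (ZMod ℓ)))
    -- assertion (A1)
    (hA1 : ∀ C : IntermediateField ℚ Om, C ≤ L r →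
      ∀ k ≤ r + 1, Normal ℚ ↥C → IsCyclic (↥C ≃ₐ[ℚ] ↥C) →
      Nat.card (↥C ≃ₐ[ℚ] ↥C) = 2 ^ k →
      ∀ [NumberField ↥C], ∀ p : ℕ, p.Prime → (p : ℤ) ∣ NumberField.discr ↥C → p = ℓ)
    -- assertion (A2)
    (hA2 : ∀ i < r, ∀ α α' : Om, α ∈ (minpoly ℚ (δ i)).rootSet Om →
      α' ∈ (minpoly ℚ (δ i)).rootSet Om → α ≠ α' →
      ∃ j ≤ i, ¬ (κ (j + 1) ≤ ℚ⟮α' / α⟯) ∧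
        Nonempty (↥(κ (j + 1)) →ₐ[ℚ]
          (Polynomial ℚ ⧸ Ideal.span
            {(minpoly ℚ (α' / α)).comp (Polynomial.X ^ 2 : Polynomial ℚ)})))
    -- assertion (A3)
    (hA3 : ∀ i < r, ∃ v : ℕ, v.Prime ∧
      Squarefree ((F i).map (Int.castRingHom (ZMod v))) ∧
      (∃ g : Fin ((F i).natDegree) → ZMod v,
        (F i).map (Int.castRingHom (ZMod v)) =
          ∏ k : Fin ((F i).natDegree), (Polynomial.X - Polynomial.C (g k))) ∧
      ¬ (∃ g : Fin ((F (i + 1)).natDegree) → ZMod v,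
        (F (i + 1)).map (Int.castRingHom (ZMod v)) =
          ∏ k : Fin ((F (i + 1)).natDegree), (Polynomial.X - Polynomial.C (g k))))
    -- the extra hypothesis when `r ≥ 3`
    (hextra : 3 ≤ r → ∀ i, 2 ≤ i → i < r → κ (i + 1) ≤ L i) :
    -- conclusion: for all `i ≤ r`,
    ∀ i (hi : i ≤ r),
      -- (i) there is an isomorphism `Gal(L_i/ℚ) ≃ GL₂(F_ℓ)/S_i` which is compatible
      -- with the projection to `PGL₂(F_ℓ)` and the restriction to `Gal(L_0/ℚ)`, ...
      ∃ φ : (↥(L i) ≃ₐ[ℚ] ↥(L i)) ≃* (GL (Fin 2) (ZMod ℓ) ⧸ ZS ℓ i),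
        (∀ σ : ↥(L i) ≃ₐ[ℚ] ↥(L i), ∃ τ : ↥(L 0) ≃ₐ[ℚ] ↥(L 0),
          (∀ x : Om, ∀ hx : x ∈ L 0,
            ((σ ⟨x, hL0le i hi hx⟩ : ↥(L i)) : Om) = ((τ ⟨x, hx⟩ : ↥(L 0)) : Om)) ∧
          projQ ℓ i (φ σ) = φ₀ τ) ∧
        -- (ii) ... and which can be chosen together with a bijection `Z_i → V_i` making
        -- the Galois action on `Z_i` equivalent to the natural action of
        -- `GL₂(F_ℓ)/S_i` on `V_i`.
        ∃ b : ↥((F i).rootSet Om) ≃ Vq ℓ i,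
          ∀ σ : ↥(L i) ≃ₐ[ℚ] ↥(L i), ∀ x y : ↥((F i).rootSet Om),
            σ ⟨(x : Om), hZL i hi (x : Om) x.2⟩ = ⟨(y : Om), hZL i hi (y : Om) y.2⟩ →
            b y = qAct ℓ i (φ σ) (b x) := by
  have hLnf : ∀ i ≤ r, Normal ℚ (L i) ∧ FiniteDimensional ℚ (L i) := fun i hi => by
    rw [hL i hi]
    exact normal_adjoin_rootSet _
  have hLr : ∀ i ≤ r, L i ≤ L r := fun i hi =>
    Nat.decreasingInduction' (P := fun i => L i ≤ L r) (fun k hk _ h => (hLmono k hk).trans h)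
      hi le_rfl
  have hκle : ∀ i ≤ r, ∀ j ≤ i, κ j ≤ κ i := fun i hi j hj =>
    Nat.decreasingInduction' (P := fun j => κ j ≤ κ i)
      (fun k hk _ h => (hκmono k (hk.trans_le hi)).le.trans h) hj le_rfl
  have hℓ2 : ℓ ≠ 2 := by omega
  have hunr : ∀ C ≤ L r, ∀ k ≤ r + 1, Normal ℚ C → IsCyclic (C ≃ₐ[ℚ] C) →
      Nat.card (C ≃ₐ[ℚ] C) = 2 ^ k → UnramifiedOutside ℓ C :=
    fun C hC k hk h1 h2 h3 _ => hA1 C hC k hk h1 h2 h3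
  have hKfix : ∀ i ≤ r, ∀ σ, σ ∈ (K i).fixingSubgroup ↔ σ (z i) = z i := fun i hi σ => by
    rw [hK i hi, mem_adjoin_simple_fixingSubgroup_iff]
  have hKL : ∀ i ≤ r, K i ≤ L i := fun i hi => by
    rw [hK i hi, IntermediateField.adjoin_simple_le_iff]
    exact hZL i hi _ (hz i hi)
  have hL0n := (hLnf 0 (Nat.zero_le r)).1
  obtain ⟨v, hv⟩ : ∃ v, vClass ℓ 0 v = θ 0 (Nat.zero_le r) ⟨z 0, hz 0 (Nat.zero_le r)⟩ :=
    Quotient.exists_rep _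
  let Ψ₀ := φ₀.toMonoidHom.comp (AlgEquiv.restrictNormalHom (F := ℚ) (K₁ := Om) (L 0))
  have hΨ₀ : Function.Surjective Ψ₀ :=
    φ₀.surjective.comp (AlgEquiv.restrictNormalHom_surjective (F := ℚ) (K₁ := L 0) Om)
  have hker₀ : Ψ₀.ker = (L 0).fixingSubgroup :=
    (MonoidHom.ker_mulEquiv_comp _ φ₀).trans (ker_restrictNormalHom (L 0))
  have main : ∀ i ≤ r, ∃ Ψ : (Om ≃ₐ[ℚ] Om) →* GL (Fin 2) (ZMod ℓ) ⧸ ZS ℓ i,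
      Function.Surjective Ψ ∧ Ψ.ker = (L i).fixingSubgroup ∧
      (∀ σ, projQ ℓ i (Ψ σ) = φ₀ (AlgEquiv.restrictNormalHom (F := ℚ) (K₁ := Om) (L 0) σ)) ∧
      ∀ σ, σ ∈ (K i).fixingSubgroup ↔ qAct ℓ i (Ψ σ) (vClass ℓ i v) = vClass ℓ i v := by
    intro i
    induction i with
    | zero =>
      intro hi
      refine ⟨Ψ₀, hΨ₀, hker₀, fun σ => projQ_zero_apply _, fun σ => ?_⟩
      · have hcomm : ((AlgEquiv.restrictNormalHom (F := ℚ) (K₁ := Om) (L 0) σ)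
            ⟨z 0, hZL 0 hi _ (hz 0 hi)⟩ : Om) = σ (z 0) :=
          AlgEquiv.restrictNormal_commutes σ (L 0) ⟨z 0, hZL 0 hi _ (hz 0 hi)⟩
        have hact := hφ₀equiv (AlgEquiv.restrictNormalHom (F := ℚ) (K₁ := Om) (L 0) σ)
          ⟨z 0, hz 0 hi⟩ ⟨σ (z 0), apply_mem_rootSet (hz 0 hi) σ⟩ (Subtype.ext hcomm)
        rw [hKfix 0 hi, hv]
        change _ ↔ qAct ℓ 0 (φ₀ (AlgEquiv.restrictNormalHom (F := ℚ) (K₁ := Om) (L 0) σ)) _ = _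
        rw [← hact, (θ 0 hi).injective.eq_iff, Subtype.mk.injEq]
    | succ i ih =>
      intro hir
      obtain ⟨Ψ, hΨ, hker, hproj, hstab⟩ := ih (by omega)
      obtain ⟨hn, hfin⟩ := hLnf i (by omega)
      obtain ⟨hn', hfin'⟩ := hLnf (i + 1) hir
      have hfin0 := (hLnf 0 (Nat.zero_le r)).2
      have hκ1deg : Module.finrank ℚ (κ 1) = 2 := by simpa using hκdeg 1 (by omega)
      have hκ1 : κ 1 ≤ L 0 := by
        refine quadratic_le hℓ2 ?_ (hκcyclo 1 (by omega)) hκ1deg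
          (fun C hC h1 h2 h3 => hunr C (hC.trans (hLr 0 (Nat.zero_le r))) 1 (by omega) h1 h2 h3)
          Ψ₀ hΨ₀ hker₀
        rw [hrm]
        exact (dvd_pow_self 2 (by omega)).mul_right m
      have hκL : κ (i + 1) ≤ L i := by
        match i with
        | 0 => exact hκ1
        | 1 =>
          refine quartic_le hℓ2 ?_ (hκcyclo 2 hir) (by simpa using hκdeg 2 hir)
            (fun C hC h1 h2 h3 => hunr C (hC.trans (hLr 1 (by omega))) 2 (by omega) h1 h2 h3)
            Ψ hΨ hker
          rw [hrm]
          exact (pow_dvd_pow 2 hir).mul_right m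
        | i + 2 => exact hextra (by omega) (i + 2) (by omega) hir
      have hδL : δ i ∈ L i := hKL i (by omega)
        (hδprim i hir ▸ IntermediateField.mem_adjoin_simple_self ℚ (δ i))
      have hconj : ∀ σ : Om ≃ₐ[ℚ] Om, (∀ τ : Om ≃ₐ[ℚ] Om, σ (τ (z (i + 1))) = τ (z (i + 1))) →
          σ ∈ (L (i + 1)).fixingSubgroup := by
        intro σ hσ
        rw [hL (i + 1) hir]
        refine mem_fixingSubgroup_of_forall_rootSet fun x hx => ?_
        obtain ⟨τ, rfl⟩ := exists_apply_eq_of_mem_rootSet (hFmonic _ hir) (hFirr _ hir)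
          (hz _ hir) hx
        exact hσ τ
      have key : ∀ τ : Om ≃ₐ[ℚ] Om, τ (δ i) ≠ δ i → τ (sqrtδ i) / sqrtδ i ∈ L i := by
        intro τ hτ
        have hδalg : IsIntegral ℚ (δ i) := (hδint i hir).tower_top
        have hroot : ∀ σ : Om ≃ₐ[ℚ] Om, σ (δ i) ∈ (minpoly ℚ (δ i)).rootSet Om := by
          intro σ
          rw [mem_rootSet]
          refine ⟨minpoly.ne_zero hδalg, ?_⟩
          rw [← AlgEquiv.coe_toAlgHom, aeval_algHom_apply, minpoly.aeval, map_zero]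
        obtain ⟨j, hj, hnot, ⟨f⟩⟩ := hA2 i hir (δ i) (τ (δ i)) (hroot 1) (hroot τ) (Ne.symm hτ)
        obtain ⟨hκn, -⟩ := isCyclic_gal_of_le_cyclo (hκcyclo (j + 1) (by omega))
        have hτδ : τ (δ i) ∈ L i := by
          have := AlgEquiv.restrictNormal_commutes τ (L i) ⟨δ i, hδL⟩
          exact this ▸ Subtype.prop _
        refine mem_of_algHom_quotient (β := τ (δ i) / δ i) ?_
          ((hκle (i + 1) hir (j + 1) (by omega)).trans hκL) (div_mem hτδ hδL) hnot f
        rw [div_pow, ← map_pow, hsqrtδ i hir]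
      have hne : ¬ L (i + 1) ≤ L i := by
        obtain ⟨p, hp, hsq, hspl, hnot⟩ := hA3 i hir
        rw [hL (i + 1) hir, hL i (by omega)]
        exact not_adjoin_rootSet_le (hFmonic i (by omega)) (hFmonic (i + 1) hir) hp hsq hspl hnot
      have hchar : ∀ J : Subgroup (Om ≃ₐ[ℚ] Om), J.index = 2 → (L (i + 1)).fixingSubgroup ≤ J →
          (L i).fixingSubgroup ≤ J := by
        intro J hJ hle
        rw [eq_fixingSubgroup_of_index_two hℓ2 (hκcyclo 1 (by omega)) hκ1deg
          (fun C hC h1 h2 h3 => hunr C (hC.trans (hLr (i + 1) hir)) 1 (by omega) h1 h2 h3) hJ hle]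
        exact IntermediateField.fixingSubgroup_le (hκ1.trans (hL0le i (by omega)))
      obtain ⟨Ψ', hΨ', hker', hproj', hstab'⟩ := exists_lift_of_tower_step hℓ2 (hsqrtδ i hir)
        (hδprim i hir).symm (hKsucc i hir) (hK (i + 1) hir) (hKL i (by omega)) (hLmono i hir)
        (hKL (i + 1) hir) hconj key hne hchar Ψ hΨ hker v hstab
      exact ⟨Ψ', hΨ', hker', fun σ => (hproj' σ).trans (hproj σ), hstab'⟩
  intro i hi
  obtain ⟨Ψ, hΨ, hker, hproj, hstab⟩ := main i hi
  have hn := (hLnf i hi).1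
  have hsurj := AlgEquiv.restrictNormalHom_surjective (F := ℚ) (K₁ := L i) Om
  obtain ⟨φ, hφ⟩ := exists_mulEquiv_of_ker_eq hsurj hΨ
    ((ker_restrictNormalHom (L i)).trans hker.symm)
  obtain ⟨b, hb⟩ := exists_equiv_rootSet (hFmonic i hi) (hFirr i hi) (hz i hi) Ψ hΨ v
    fun σ => (hKfix i hi σ).symm.trans (hstab σ)
  refine ⟨φ, fun σ => ?_, b, fun σ x y hxy => ?_⟩
  · obtain ⟨σ, rfl⟩ := hsurj σ
    refine ⟨AlgEquiv.restrictNormalHom (F := ℚ) (K₁ := Om) (L 0) σ, fun x hx => ?_, ?_⟩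
    · exact (AlgEquiv.restrictNormal_commutes σ (L i) ⟨x, hL0le i hi hx⟩).trans
        (AlgEquiv.restrictNormal_commutes σ (L 0) ⟨x, hx⟩).symm
    · rw [hφ, hproj]
  · obtain ⟨σ, rfl⟩ := hsurj σ
    rw [hφ]
    refine hb σ x y ?_
    exact (AlgEquiv.restrictNormal_commutes σ (L i) ⟨x, hZL i hi x x.2⟩).symm.trans
      (congrArg Subtype.val hxy)
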